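/- Let T be a Y(1|2) T-family in A, let M be a left A-module with highest weight vector Ω, let a ≥ 0, b ≥ 1, and let ū = (u₁,…,u_a), v̄ = (v₁,…,v_b) have admissible concatenation. Define Φ̃_{a,b}(ū,v̄) = (−1)^b Σ K_ℓ(ū_I|v̄_I)·f(v̄_I,v̄_II)·g(ū_II,ū_I)·λ₂(v̄_I)·𝕋₁₃(ū_I)·𝕋₁₂(ū_II)·T₂₃(v̄_II)·Ω (sum over all partitions ū = ū_I ⊔ ū_II, v̄ = v̄_I ⊔ v̄_II with #ū_I = #v̄_I = ℓ). Then Φ̃_{a,b}(ū,v̄) = −T₂₃(v₁)·Φ̃_{a,b−1}(ū,v̄₁) − Σ_{j=1}^{a} λ₂(uⱼ)·g(uⱼ,v₁)·f(uⱼ,v̄₁)·g(ūⱼ,uⱼ)·T₁₃(v₁)·Φ̃_{a−1,b−1}(ūⱼ,v̄₁), where v̄₁ = v̄ with v₁ removed, ūⱼ = ū with uⱼ removed, and g(ūⱼ,uⱼ) = ∏_{k≠j} g(uₖ,uⱼ). -/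

import Mathlib

open scoped BigOperators
open MulOpposite

noncomputable section

namespace Bethe

variable {A : Type*} [Ring A] [Algebra ℂ A]

/-- `g(u,v) = c/(u-v)` -/
def gg (c u v : ℂ) : ℂ := c / (u - v)

/-- `f(u,v) = (u-v+c)/(u-v)` -/
def ff (c u v : ℂ) : ℂ := (u - v + c) / (u - v)

/-- `h(u,v) = (u-v+c)/c` -/
def hh (c u v : ℂ) : ℂ := (u - v + c) / c

/-- A list of parameters is admissible if its entries are pairwise distinct and
`x - y + c ≠ 0` for any two distinct entries `x`, `y`. -/
def Admissible (c : ℂ) (l : List ℂ) : Prop :=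
  l.Pairwise fun x y => x ≠ y ∧ x - y + c ≠ 0 ∧ y - x + c ≠ 0

/-- `∏_{x ∈ xs} ∏_{y ∈ ys} f(x,y)` -/
def prodFF (c : ℂ) (xs ys : List ℂ) : ℂ :=
  (xs.map fun x => (ys.map fun y => ff c x y).prod).prod

/-- `∏_{x ∈ xs} ∏_{y ∈ ys} g(x,y)` -/
def prodGG (c : ℂ) (xs ys : List ℂ) : ℂ :=
  (xs.map fun x => (ys.map fun y => gg c x y).prod).prod

/-- `∏_{x ∈ xs} ∏_{y ∈ ys} h(x,y)` -/
def prodHH (c : ℂ) (xs ys : List ℂ) : ℂ :=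
  (xs.map fun x => (ys.map fun y => hh c x y).prod).prod

/-- `H(w̄) = ∏_{j>k} h(wⱼ,wₖ)` -/
def Hnorm (c : ℂ) : List ℂ → ℂ
  | [] => 1
  | x :: xs => ((xs.map fun y => hh c y x).prod) * Hnorm c xs

/-- `H(w̄*) = ∏_{j<k} h(wⱼ,wₖ)` -/
def HnormRev (c : ℂ) : List ℂ → ℂ
  | [] => 1
  | x :: xs => ((xs.map fun y => hh c x y).prod) * HnormRev c xs

/-- product of `h` over ordered pairs of distinct positions of a list -/
def prodHHne (c : ℂ) (xs : List ℂ) : ℂ :=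
  ∏ j : Fin xs.length, ∏ k : Fin xs.length,
    if j ≠ k then hh c (xs.get j) (xs.get k) else 1

/-- ordered product `T(w₁)⋯T(wₙ)` -/
def Tprod (Tij : ℂ → A) (l : List ℂ) : A := (l.map Tij).prod

/-- normalized ordered product `H(w̄)⁻¹ T(w₁)⋯T(wₙ)` -/
def TT (c : ℂ) (Tij : ℂ → A) (l : List ℂ) : A := (Hnorm c l)⁻¹ • Tprod Tij l

/-- normalized ordered product `H(w̄*)⁻¹ T(w₁)⋯T(wₙ)` -/
def TTrev (c : ℂ) (Tij : ℂ → A) (l : List ℂ) : A := (HnormRev c l)⁻¹ • Tprod Tij l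

/-- The defining (RTT) commutation relations of a super-Yangian `T`-family with
`ℤ₂`-grading `p`. -/
def IsTFam (c : ℂ) {N : ℕ} (p : Fin N → ℕ) (T : Fin N → Fin N → ℂ → A) : Prop :=
  ∀ i j k l : Fin N, ∀ z w : ℂ, z ≠ w →
    T i j z * T k l w - ((-1 : ℂ) ^ ((p i + p j) * (p k + p l))) • (T k l w * T i j z)
      = ((-1 : ℂ) ^ (p l * (p i + p j) + p i * p j) * gg c z w) •
          (T i l z * T k j w - T i l w * T k j z)

/-- the distinguished grading of `gl(2|1)`: `[1]=[2]=0`, `[3]=1` -/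
def p21 : Fin 3 → ℕ := ![0, 0, 1]

/-- the distinguished grading of `gl(1|2)`: `[1]=0`, `[2]=[3]=1` -/
def p12 : Fin 3 → ℕ := ![0, 1, 1]

/-- the sublist of `l` given by the positions in `S`, in the inherited order -/
def sel (l : List ℂ) (S : Finset (Fin l.length)) : List ℂ :=
  (S.sort (· ≤ ·)).map l.get

/-- `λ(w̄) = ∏ⱼ λ(wⱼ)` -/
def lamP (lam2 : ℂ → ℂ) (l : List ℂ) : ℂ := (l.map lam2).prod

/-- The Izergin kernel `K_ℓ(v̄|ū)`. -/
def Kiz (c : ℂ) {ℓ : ℕ} (vs us : Fin ℓ → ℂ) : ℂ :=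
  (∏ j : Fin ℓ, ∏ k : Fin ℓ, if (k : ℕ) < (j : ℕ) then gg c (vs j) (vs k) else 1) *
    (∏ j : Fin ℓ, ∏ k : Fin ℓ, if (k : ℕ) < (j : ℕ) then gg c (us k) (us j) else 1) *
    (∏ j : Fin ℓ, ∏ k : Fin ℓ, hh c (vs j) (us k)) *
    Matrix.det (Matrix.of fun j k => gg c (vs j) (us k) / hh c (vs j) (us k))

/-- The Izergin kernel for lists of equal length (and junk value `0` otherwise). -/
def KizL (c : ℂ) (vs us : List ℂ) : ℂ :=
  if h : vs.length = us.length then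
    Kiz c vs.get fun j => us.get (Fin.cast h j)
  else 0

/-- The operator `X_{a,b}(ū,v̄)` of the paper (`Y(2|1)` case). -/
def X (c : ℂ) (T : Fin 3 → Fin 3 → ℂ → A) (u v : List ℂ) : A :=
  ∑ S : Finset (Fin u.length), ∑ Q : Finset (Fin v.length),
    if S.card = Q.card then
      (prodGG c (sel v Q) (sel u S) * prodFF c (sel u S) (sel u Sᶜ) *
          prodGG c (sel v Qᶜ) (sel v Q) * prodHHne c (sel u S)) •
        (TT c (T 0 2) (sel u S) * Tprod (T 0 1) (sel u Sᶜ) *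
          TT c (T 1 2) (sel v Qᶜ) * Tprod (T 1 1) (sel v Q))
    else 0

/-- The operator `Y_{a,b}(ū,v̄)` of the paper (`Y(2|1)` case). -/
def Y (c : ℂ) (T : Fin 3 → Fin 3 → ℂ → A) (u v : List ℂ) : A :=
  ∑ S : Finset (Fin u.length), ∑ Q : Finset (Fin v.length),
    if S.card = Q.card then
      (KizL c (sel v Q) (sel u S) * prodFF c (sel u S) (sel u Sᶜ) *
          prodGG c (sel v Qᶜ) (sel v Q)) •
        (TT c (T 0 2) (sel v Q) * TT c (T 1 2) (sel v Qᶜ) *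
          Tprod (T 0 1) (sel u Sᶜ) * Tprod (T 1 1) (sel u S))
    else 0

/-- First explicit expression for the `Y(2|1)` Bethe vector (operator part,
the weights `λ₂` included as scalars). -/
def PhiA (c : ℂ) (T : Fin 3 → Fin 3 → ℂ → A) (lam2 : ℂ → ℂ) (u v : List ℂ) : A :=
  ∑ S : Finset (Fin u.length), ∑ Q : Finset (Fin v.length),
    if S.card = Q.card then
      (prodGG c (sel v Q) (sel u S) * prodFF c (sel u S) (sel u Sᶜ) *
          prodGG c (sel v Qᶜ) (sel v Q) * prodHHne c (sel u S) * lamP lam2 (sel v Q)) •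
        (TT c (T 0 2) (sel u S) * Tprod (T 0 1) (sel u Sᶜ) * TT c (T 1 2) (sel v Qᶜ))
    else 0

/-- Second explicit expression for the `Y(2|1)` Bethe vector (operator part). -/
def PhiB (c : ℂ) (T : Fin 3 → Fin 3 → ℂ → A) (lam2 : ℂ → ℂ) (u v : List ℂ) : A :=
  ∑ S : Finset (Fin u.length), ∑ Q : Finset (Fin v.length),
    if S.card = Q.card then
      (KizL c (sel v Q) (sel u S) * prodFF c (sel u S) (sel u Sᶜ) *
          prodGG c (sel v Qᶜ) (sel v Q) * lamP lam2 (sel u S)) •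
        (TT c (T 0 2) (sel v Q) * TT c (T 1 2) (sel v Qᶜ) * Tprod (T 0 1) (sel u Sᶜ))
    else 0

/-- First explicit expression for the `Y(1|2)` Bethe vector, without the overall
sign `(-1)^b` (operator part). -/
def PhiTA (c : ℂ) (T : Fin 3 → Fin 3 → ℂ → A) (lam2 : ℂ → ℂ) (u v : List ℂ) : A :=
  ∑ S : Finset (Fin u.length), ∑ Q : Finset (Fin v.length),
    if S.card = Q.card then
      (prodGG c (sel u S) (sel v Q) * prodFF c (sel v Q) (sel v Qᶜ) *
          prodGG c (sel u Sᶜ) (sel u S) * prodHHne c (sel v Q) * lamP lam2 (sel u S)) •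
        (TT c (T 0 2) (sel v Q) * Tprod (T 1 2) (sel v Qᶜ) * TT c (T 0 1) (sel u Sᶜ))
    else 0

/-- Second explicit expression for the `Y(1|2)` Bethe vector, without the overall
sign `(-1)^b` (operator part). -/
def PhiTB (c : ℂ) (T : Fin 3 → Fin 3 → ℂ → A) (lam2 : ℂ → ℂ) (u v : List ℂ) : A :=
  ∑ S : Finset (Fin u.length), ∑ Q : Finset (Fin v.length),
    if S.card = Q.card then
      (KizL c (sel u S) (sel v Q) * prodFF c (sel v Q) (sel v Qᶜ) *
          prodGG c (sel u Sᶜ) (sel u S) * lamP lam2 (sel v Q)) •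
        (TT c (T 0 2) (sel u S) * TT c (T 0 1) (sel u Sᶜ) * Tprod (T 1 2) (sel v Qᶜ))
    else 0

/-- First explicit expression for the dual `Y(2|1)` Bethe vector, without the
overall sign `(-1)^{b(b-1)/2}`.  `E` is a right `A`-module, i.e. a left
`Aᵐᵒᵖ`-module; `op X • Ωd` is `Ωd · X`. -/
def PsiA {E : Type*} [AddCommGroup E] [Module ℂ E] [Module Aᵐᵒᵖ E]
    (c : ℂ) (T : Fin 3 → Fin 3 → ℂ → A) (lam2 : ℂ → ℂ) (u v : List ℂ) (Ωd : E) : E :=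
  ∑ S : Finset (Fin u.length), ∑ Q : Finset (Fin v.length),
    if S.card = Q.card then
      (prodGG c (sel v Q) (sel u S) * prodFF c (sel u S) (sel u Sᶜ) *
          prodGG c (sel v Qᶜ) (sel v Q) * prodHHne c (sel u S) * lamP lam2 (sel v Q)) •
        (op (TTrev c (T 2 1) (sel v Qᶜ) * Tprod (T 1 0) (sel u Sᶜ) *
              TTrev c (T 2 0) (sel u S)) • Ωd)
    else 0

/-- The dual `Y(2|1)` Bethe vector `Ψ_{a,b}(ū,v̄)`. -/
def Psi {E : Type*} [AddCommGroup E] [Module ℂ E] [Module Aᵐᵒᵖ E]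
    (c : ℂ) (T : Fin 3 → Fin 3 → ℂ → A) (lam2 : ℂ → ℂ) (u v : List ℂ) (Ωd : E) : E :=
  ((-1 : ℂ) ^ (v.length * (v.length - 1) / 2)) • PsiA c T lam2 u v Ωd

/-- Second explicit expression for the dual `Y(2|1)` Bethe vector, without the
overall sign `(-1)^{b(b-1)/2}`. -/
def PsiB {E : Type*} [AddCommGroup E] [Module ℂ E] [Module Aᵐᵒᵖ E]
    (c : ℂ) (T : Fin 3 → Fin 3 → ℂ → A) (lam2 : ℂ → ℂ) (u v : List ℂ) (Ωd : E) : E :=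
  ∑ S : Finset (Fin u.length), ∑ Q : Finset (Fin v.length),
    if S.card = Q.card then
      (KizL c (sel v Q) (sel u S) * prodFF c (sel u S) (sel u Sᶜ) *
          prodGG c (sel v Qᶜ) (sel v Q) * lamP lam2 (sel u S)) •
        (op (Tprod (T 1 0) (sel u Sᶜ) * TTrev c (T 2 1) (sel v Qᶜ) *
              TTrev c (T 2 0) (sel v Q)) • Ωd)
    else 0

set_option linter.unusedSimpArgs false

theorem gg_antisymm (c x y : ℂ) : gg c y x = - gg c x y := by
  unfold gg; rw [← neg_sub x y, div_neg]

theorem ff_eq (c : ℂ) {x y : ℂ} (h : x ≠ y) : ff c x y = 1 + gg c x y := by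
  unfold ff gg; have := sub_ne_zero.2 h; field_simp

theorem hh_mul_gg {c : ℂ} (hc : c ≠ 0) {x y : ℂ} (h : x ≠ y) : hh c x y * gg c x y = ff c x y := by
  unfold hh ff gg; have := sub_ne_zero.2 h; field_simp

/-- the basic three-term identity -/
theorem gg_three (c : ℂ) {x y z : ℂ} (hxy : x ≠ y) (hyz : y ≠ z) (hxz : x ≠ z) :
    gg c x y * gg c y z = gg c x z * (gg c x y + gg c y z) := by
  unfold gg
  have h1 := sub_ne_zero.2 hxy
  have h2 := sub_ne_zero.2 hyz
  have h3 := sub_ne_zero.2 hxz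
  field_simp; ring

/-- partial fractions of `f(X,z) g(z,k)` in `z` -/
theorem pf_ff (c : ℂ) (k : ℂ) (X : Finset ℂ) (hk : k ∉ X) :
    ∀ z : ℂ, z ∉ X → z ≠ k →
    (∏ x ∈ X, ff c x z) * gg c z k = gg c z k * (∏ x ∈ X, ff c x k)
      + ∑ x ∈ X, gg c x z * (∏ y ∈ X.erase x, ff c y x) * gg c x k := by
  classical
  induction X using Finset.induction_on with
  | empty => intro z _ _; simp
  | insert y X hy ih =>
    intro z hz hzk
    simp only [Finset.mem_insert, not_or] at hz hk
    have ih' := ih hk.2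
    have e1 := ih' z hz.2 hzk
    have e2 := ih' y hy (Ne.symm hk.1)
    rw [Finset.prod_insert hy, Finset.prod_insert hy, Finset.sum_insert hy, Finset.erase_insert hy]
    have e3 : ∑ x ∈ X, gg c x z * (∏ w ∈ (insert y X).erase x, ff c w x) * gg c x k
        = ∑ x ∈ X, (gg c x z * ff c y x) * ((∏ w ∈ X.erase x, ff c w x) * gg c x k) := by
      refine Finset.sum_congr rfl fun x hx => ?_
      have hxy : y ≠ x := fun h => hy (h ▸ hx)
      rw [Finset.erase_insert_of_ne hxy, Finset.prod_insert (by simp [hy])]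
      ring
    have e4 : ff c y z * ∑ x ∈ X, gg c x z * (∏ w ∈ X.erase x, ff c w x) * gg c x k
        = gg c y z * (∑ x ∈ X, gg c x y * (∏ w ∈ X.erase x, ff c w x) * gg c x k)
          + ∑ x ∈ X, (gg c x z * ff c y x) * ((∏ w ∈ X.erase x, ff c w x) * gg c x k) := by
      rw [Finset.mul_sum, Finset.mul_sum, ← Finset.sum_add_distrib]
      refine Finset.sum_congr rfl fun x hx => ?_
      have hxy : y ≠ x := fun h => hy (h ▸ hx)
      have hxz : x ≠ z := fun h => hz.2 (h ▸ hx)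
      rw [ff_eq c (Ne.symm hz.1), ff_eq c hxy]
      have := gg_three c hxy.symm (Ne.symm hz.1) hxz
      rw [gg_antisymm c x y]
      linear_combination -((∏ w ∈ X.erase x, ff c w x) * gg c x k) * this
    rw [e3]
    have e5 : ff c y z * gg c z k = gg c z k * ff c y k + gg c y z * gg c y k := by
      rw [ff_eq c (Ne.symm hz.1), ff_eq c (Ne.symm hk.1)]
      have := gg_three c (Ne.symm hz.1) hzk (Ne.symm hk.1)
      linear_combination this
    linear_combination ff c y z * e1 + e4 - gg c y z * e2 + (∏ x ∈ X, ff c x k) * e5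

/-- The commutation relations needed, as relations between linear operators. -/
structure Rel {M : Type*} [AddCommGroup M] [Module ℂ M] (c : ℂ)
    (t01 t02 t12 t11 : ℂ → M →ₗ[ℂ] M) : Prop where
  r0102 : ∀ z w, z ≠ w → ∀ m, t01 z (t02 w m)
    = -(ff c w z • t02 w (t01 z m)) - gg c z w • t02 z (t01 w m)
  r0112 : ∀ z w, z ≠ w → ∀ m, t01 z (t12 w m)
    = t12 w (t01 z m) - gg c z w • (t02 z (t11 w m) - t02 w (t11 z m))
  r1202 : ∀ z w, z ≠ w → ∀ m, t12 w (t02 z m)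
    = ff c z w • t02 z (t12 w m) - gg c z w • t02 w (t12 z m)
  r0202 : ∀ z w, z ≠ w → ∀ m, ff c z w • t02 z (t02 w m) = -(ff c w z • t02 w (t02 z m))
  r0101 : ∀ z w, z ≠ w → ∀ m, ff c z w • t01 z (t01 w m) = -(ff c w z • t01 w (t01 z m))
  r1212 : ∀ z w, z ≠ w → ∀ m, t12 z (t12 w m) = t12 w (t12 z m)
  r1101 : ∀ z w, z ≠ w → ∀ m, t11 w (t01 z m)
    = ff c z w • t01 z (t11 w m) + gg c w z • t01 w (t11 z m)
  r1102 : ∀ z w, z ≠ w → ∀ m, t11 w (t02 z m)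
    = t02 z (t11 w m) + gg c z w • (t01 z (t12 w m) - t01 w (t12 z m))
  r1112 : ∀ z w, z ≠ w → ∀ m, t11 w (t12 z m)
    = ff c w z • t12 z (t11 w m) + gg c z w • t12 w (t11 z m)

/-- coefficient attached to an element `j` of `U` -/
def cP (c : ℂ) (l : ℂ → ℂ) (U : Finset ℂ) (j : ℂ) : ℂ := l j * ∏ x ∈ U.erase j, gg c x j
/-- `f(j,V)` -/
def cF (c : ℂ) (V : Finset ℂ) (j : ℂ) : ℂ := ∏ y ∈ V, ff c j y
/-- `f(U,k)` -/
def cG (c : ℂ) (U : Finset ℂ) (k : ℂ) : ℂ := ∏ x ∈ U, ff c x k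
/-- coefficient attached to an element `k` of `V` -/
def cL (c : ℂ) (l : ℂ → ℂ) (U V : Finset ℂ) (k : ℂ) : ℂ :=
  l k * cF c (V.erase k) k * cG c U k
/-- `h(U,z)` -/
def cH (c : ℂ) (U : Finset ℂ) (z : ℂ) : ℂ := ∏ x ∈ U, hh c x z

section
variable {M : Type*} [AddCommGroup M] [Module ℂ M]

theorem sum_symm_zero (V : Finset ℂ) (F : ℂ → ℂ → M)
    (h : ∀ k ∈ V, ∀ m ∈ V, k ≠ m → F k m + F m k = 0) :
    ∑ k ∈ V, ∑ m ∈ V.erase k, F k m = 0 := by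
  classical
  have h1 : ∑ k ∈ V, ∑ m ∈ V.erase k, F k m = ∑ k ∈ V, ∑ m ∈ V.erase k, F m k := by
    refine Finset.sum_comm' ?_
    intro x y
    simp only [Finset.mem_erase]
    tauto
  have h2 : ∑ k ∈ V, ∑ m ∈ V.erase k, F k m + ∑ k ∈ V, ∑ m ∈ V.erase k, F m k = 0 := by
    simp only [← Finset.sum_add_distrib]
    refine Finset.sum_eq_zero fun k hk => Finset.sum_eq_zero fun m hm => ?_
    rw [Finset.mem_erase] at hm
    exact h k hk m hm.2 (Ne.symm hm.1)
  rw [← h1, ← two_smul ℂ] at h2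
  exact (smul_eq_zero.1 h2).resolve_left two_ne_zero

variable (c : ℂ) (l : ℂ → ℂ) (t01 t02 t12 t11 : ℂ → M →ₗ[ℂ] M) (Φ : Finset ℂ → Finset ℂ → M)

/-- recursion in the second set of variables -/
def RecV (U V : Finset ℂ) (w : ℂ) : Prop :=
  Φ U (insert w V) = t12 w (Φ U V)
    + ∑ j ∈ U, (cP c l U j * cF c V j * gg c j w) • t02 w (Φ (U.erase j) V)

/-- action of `T₂₂` -/
def ActD (U V : Finset ℂ) (w : ℂ) : Prop :=
  t11 w (Φ U V) = (l w * cF c V w * cG c U w) • Φ U V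
    + ∑ k ∈ V, (gg c k w * cL c l U V k) • Φ U (insert w (V.erase k))
    + ∑ j ∈ U, (gg c w j * cP c l U j * cF c V j) • t01 w (Φ (U.erase j) V)

/-- recursion in the first set of variables -/
def RecU (U V : Finset ℂ) (z : ℂ) : Prop :=
  cH c U z • Φ (insert z U) V = t01 z (Φ U V)
    + ∑ k ∈ V, (gg c z k * cL c l U V k) • t02 z (Φ U (V.erase k))

variable {c l t01 t02 t12 t11 Φ}

theorem cL_insert {U V : Finset ℂ} {w k : ℂ} (hw : w ∉ V) (hk : k ∈ V) :
    cL c l U (insert w V) k = cL c l U V k * ff c k w := by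
  have : w ≠ k := fun h => hw (h ▸ hk)
  unfold cL cF
  rw [Finset.erase_insert_of_ne this, Finset.prod_insert (by simp [hw])]
  ring

theorem cL_insert_self {U V : Finset ℂ} {w : ℂ} (hw : w ∉ V) :
    cL c l U (insert w V) w = l w * cF c V w * cG c U w := by
  unfold cL
  rw [Finset.erase_insert hw]

theorem cL_insert_left {U V : Finset ℂ} {z k : ℂ} (hz : z ∉ U) :
    cL c l (insert z U) V k = ff c z k * cL c l U V k := by
  unfold cL cG
  rw [Finset.prod_insert hz]
  ring

theorem cP_insert {U : Finset ℂ} {z j : ℂ} (hz : z ∉ U) (hj : j ∈ U) :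
    cP c l (insert z U) j = cP c l U j * gg c z j := by
  have : z ≠ j := fun h => hz (h ▸ hj)
  unfold cP
  rw [Finset.erase_insert_of_ne this, Finset.prod_insert (by simp [hz])]
  ring

theorem cFL {U V : Finset ℂ} {j k : ℂ} (hj : j ∈ U) (hk : k ∈ V) :
    cF c V j * cL c l (U.erase j) V k = cF c (V.erase k) j * cL c l U V k := by
  unfold cF cL cG
  rw [← Finset.mul_prod_erase V _ hk, ← Finset.mul_prod_erase U _ hj]
  ring

theorem cH_erase {U : Finset ℂ} {j z : ℂ} (hj : j ∈ U) :
    cH c U z = hh c j z * cH c (U.erase j) z := by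
  unfold cH
  rw [← Finset.mul_prod_erase U _ hj]

theorem cH_P {U : Finset ℂ} {z : ℂ} (hc : c ≠ 0) (hz : z ∉ U) :
    cH c U z * cP c l (insert z U) z = l z * cG c U z := by
  unfold cH cP cG
  rw [Finset.erase_insert hz, mul_left_comm, ← Finset.prod_mul_distrib]
  congr 1
  exact Finset.prod_congr rfl fun x hx => hh_mul_gg hc (fun h => hz (h ▸ hx))

theorem recV_step (hc : c ≠ 0) (hR : Rel c t01 t02 t12 t11) {U V : Finset ℂ} {z w : ℂ}
    (hzU : z ∉ U) (hzV : z ∉ V) (hwU : w ∉ U) (hwV : w ∉ V) (hzw : z ≠ w)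
    (hH : cH c U z ≠ 0)
    (u1 : RecU c l t01 t02 Φ U (insert w V) z) (u2 : RecU c l t01 t02 Φ U V z)
    (u3 : ∀ j ∈ U, RecU c l t01 t02 Φ (U.erase j) V z)
    (v1 : RecV c l t02 t12 Φ U V w)
    (v2 : ∀ k ∈ V, RecV c l t02 t12 Φ U (V.erase k) w)
    (v3 : ∀ k ∈ V, RecV c l t02 t12 Φ U (V.erase k) z)
    (d1 : ActD c l t01 t11 Φ U V w) (d2 : ActD c l t01 t11 Φ U V z) :
    RecV c l t02 t12 Φ (insert z U) V w := by
  unfold RecV RecU ActD at *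
  have zj : ∀ j ∈ U, z ≠ j := fun j hj h => hzU (h ▸ hj)
  have wj : ∀ j ∈ U, w ≠ j := fun j hj h => hwU (h ▸ hj)
  have zk : ∀ k ∈ V, z ≠ k := fun j hj h => hzV (h ▸ hj)
  have wk : ∀ k ∈ V, w ≠ k := fun j hj h => hwV (h ▸ hj)
  -- first sum identity
  have hj : ∑ j ∈ U, (cP c l U j * cF c V j * gg c j w) • t01 z (t02 w (Φ (U.erase j) V))
      - gg c z w • ∑ j ∈ U, (gg c w j * cP c l U j * cF c V j) • t02 z (t01 w (Φ (U.erase j) V))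
      + gg c z w • ∑ j ∈ U, (gg c z j * cP c l U j * cF c V j) • t02 w (t01 z (Φ (U.erase j) V))
      = ∑ j ∈ U, (cP c l U j * cF c V j * gg c j w * gg c z j * hh c j z) •
          t02 w (t01 z (Φ (U.erase j) V)) := by
    simp only [Finset.smul_sum, ← Finset.sum_add_distrib, ← Finset.sum_sub_distrib]
    refine Finset.sum_congr rfl fun j hj => ?_
    have e := hh_mul_gg hc (zj j hj).symm
    have e1 := gg_three c (wj j hj).symm hzw.symm (zj j hj).symm
    rw [hR.r0102 z w hzw]
    rw [ff_eq c hzw.symm]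
    rw [ff_eq c (zj j hj).symm] at e
    rw [gg_antisymm c j z, gg_antisymm c w z, gg_antisymm c j w]
    rw [gg_antisymm c z w] at *
    match_scalars
    · linear_combination (cP c l U j * cF c V j) * (- e1 + gg c j w * e)
    · ring
  have hk : ∑ k ∈ V, (gg c z k * (cL c l U V k * ff c k w)) • t02 z (Φ U (insert w (V.erase k)))
      - gg c z w • ∑ k ∈ V, (gg c k w * cL c l U V k) • t02 z (Φ U (insert w (V.erase k)))
      + gg c z w • ∑ k ∈ V, (gg c k z * cL c l U V k) • t02 w (Φ U (insert z (V.erase k)))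
      = ∑ k ∈ V, (gg c z k * cL c l U V k) • t12 w (t02 z (Φ U (V.erase k)))
        + ∑ j ∈ U, ∑ k ∈ V, (cP c l U j * cF c V j * gg c j w * gg c z j * hh c j z *
            (gg c z k * cL c l (U.erase j) V k)) •
            t02 w (t02 z (Φ (U.erase j) (V.erase k))) := by
    rw [Finset.sum_comm (s := U)]
    simp only [Finset.smul_sum, ← Finset.sum_add_distrib, ← Finset.sum_sub_distrib]
    refine Finset.sum_congr rfl fun k hk => ?_
    have e2 := gg_three c (zk k hk) (wk k hk).symm hzw
    have e3 : ∑ j ∈ U, (cP c l U j * cF c V j * gg c j w * gg c z j * hh c j z *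
            (gg c z k * cL c l (U.erase j) V k)) • t02 w (t02 z (Φ (U.erase j) (V.erase k)))
        = (gg c z k * cL c l U V k) • (
         ff c z w • (∑ j ∈ U, (cP c l U j * cF c (V.erase k) j * gg c j w) •
            t02 z (t02 w (Φ (U.erase j) (V.erase k))))
         - gg c z w • ∑ j ∈ U, (cP c l U j * cF c (V.erase k) j * gg c j z) •
            t02 w (t02 z (Φ (U.erase j) (V.erase k)))) := by
      simp only [Finset.smul_sum, ← Finset.sum_sub_distrib]
      refine Finset.sum_congr rfl fun j hj => ?_
      have e := hh_mul_gg hc (zj j hj).symm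
      have e1 := gg_three c (wj j hj).symm hzw.symm (zj j hj).symm
      have e4 := hR.r0202 z w hzw (Φ (U.erase j) (V.erase k))
      have e5 := cFL (c := c) (l := l) hj hk
      rw [smul_comm (ff c z w), e4, ff_eq c hzw.symm]
      rw [ff_eq c (zj j hj).symm] at e
      rw [gg_antisymm c j z]
      rw [gg_antisymm c w z] at *
      match_scalars
      linear_combination (cP c l U j * gg c z k * cL c l U V k * cF c (V.erase k) j) * (e1 - gg c j w * e)
       + (cP c l U j * gg c z k * gg c j w * - gg c j z * hh c j z) * e5
    rw [e3, v2 k hk, v3 k hk, hR.r1202 z w hzw, ff_eq c (wk k hk).symm, ff_eq c hzw,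
      gg_antisymm c z k]
    simp only [map_add, map_sum, map_smul]
    match_scalars
    · linear_combination (cL c l U V k) * e2
    · linear_combination (cL c l U V k) * e2
    · ring
    · ring
  have hwzj : ∀ j ∈ U, cH c U z • t02 w (Φ (insert z (U.erase j)) V)
      = hh c j z • (t02 w (t01 z (Φ (U.erase j) V))
        + ∑ k ∈ V, (gg c z k * cL c l (U.erase j) V k) •
            t02 w (t02 z (Φ (U.erase j) (V.erase k)))) := by
    intro j hj
    rw [cH_erase hj, mul_smul, ← map_smul, u3 j hj]
    simp only [map_add, map_sum, map_smul]
  have hrhs : cH c U z • ∑ j ∈ insert z U,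
        (cP c l (insert z U) j * cF c V j * gg c j w) • t02 w (Φ ((insert z U).erase j) V)
      = (l z * cG c U z * cF c V z * gg c z w) • t02 w (Φ U V)
        + ∑ j ∈ U, (cP c l U j * cF c V j * gg c j w * gg c z j * hh c j z) •
          t02 w (t01 z (Φ (U.erase j) V))
        + ∑ j ∈ U, ∑ k ∈ V, (cP c l U j * cF c V j * gg c j w * gg c z j * hh c j z *
            (gg c z k * cL c l (U.erase j) V k)) •
            t02 w (t02 z (Φ (U.erase j) (V.erase k))) := by
    rw [Finset.sum_insert hzU, Finset.erase_insert hzU, smul_add, add_assoc]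
    congr 1
    · rw [smul_smul, ← cH_P hc hzU]
      congr 1; ring
    · rw [← Finset.sum_add_distrib, Finset.smul_sum]
      refine Finset.sum_congr rfl fun j hj => ?_
      rw [Finset.erase_insert_of_ne (zj j hj), smul_comm, hwzj j hj, cP_insert hzU hj]
      simp only [smul_add, Finset.smul_sum, smul_smul]
      congr 1
      · congr 1; ring
      · refine Finset.sum_congr rfl fun k _ => ?_
        congr 1; ring
  rw [Finset.sum_insert hwV, Finset.erase_insert hwV, cL_insert_self hwV] at u1
  have e6 : ∑ k ∈ V, (gg c z k * cL c l U (insert w V) k) • t02 z (Φ U ((insert w V).erase k))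
      = ∑ k ∈ V, (gg c z k * (cL c l U V k * ff c k w)) • t02 z (Φ U (insert w (V.erase k))) := by
    refine Finset.sum_congr rfl fun k hk => ?_
    rw [cL_insert hwV hk, Finset.erase_insert_of_ne (wk k hk)]
  rw [e6, v1, map_add, hR.r0112 z w hzw, d1, d2] at u1
  refine smul_right_injective M hH ?_
  change cH c U z • _ = cH c U z • _
  rw [smul_add, hrhs, ← map_smul, u2, u1]
  simp only [map_add, map_sum, map_smul]
  linear_combination (norm := module) hj + hk

end

theorem scal_X {c z w j : ℂ} (hc : c ≠ 0) (hzw : z ≠ w) (hzj : z ≠ j) (hwj : w ≠ j) :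
    gg c w j + gg c z w * gg c z w * gg c j w - gg c z w * gg c j z * ff c z w
      = - (gg c w j * gg c z j * hh c j z * ff c z w) := by
  have h1 := sub_ne_zero.2 hzw
  have h2 := sub_ne_zero.2 hzj
  have h3 := sub_ne_zero.2 hwj
  rw [gg_antisymm c z j, gg_antisymm c w j]
  unfold gg ff hh
  field_simp
  ring

theorem scal_Y {c z w j : ℂ} (hc : c ≠ 0) (hzw : z ≠ w) (hzj : z ≠ j) (hwj : w ≠ j) :
    gg c z w * gg c j w * ff c w z - gg c z w * gg c j z * gg c w z
      = - (gg c w j * gg c z j * hh c j z * gg c w z) := by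
  rw [ff_eq c hzw.symm]
  have h1 := sub_ne_zero.2 hzw
  have h2 := sub_ne_zero.2 hzj
  have h3 := sub_ne_zero.2 hwj
  rw [gg_antisymm c z j, gg_antisymm c w j, gg_antisymm c z w]
  unfold gg hh
  field_simp
  ring

theorem scal_km {c z w k m : ℂ} (hzw : z ≠ w) (hzk : z ≠ k) (hzm : z ≠ m) (hwk : w ≠ k)
    (hwm : w ≠ m) (hkm : k ≠ m) :
    ff c k m * (gg c z k * gg c m w - gg c k w * gg c z m * ff c z k * ff c m w)
      + ff c m k * (gg c z m * gg c k w - gg c m w * gg c z k * ff c z m * ff c k w) = 0 := by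
  rw [ff_eq c hkm.symm, gg_antisymm c k m, ff_eq c hkm]
  have h1 := sub_ne_zero.2 hzw
  have h2 := sub_ne_zero.2 hzk
  have h3 := sub_ne_zero.2 hzm
  have h4 := sub_ne_zero.2 hwk.symm
  have h5 := sub_ne_zero.2 hwm.symm
  have h6 := sub_ne_zero.2 hkm
  unfold gg ff
  field_simp
  ring

section
variable {M : Type*} [AddCommGroup M] [Module ℂ M]
variable {c : ℂ} {l : ℂ → ℂ} {t01 t02 t12 t11 : ℂ → M →ₗ[ℂ] M} {Φ : Finset ℂ → Finset ℂ → M}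

theorem actD_step (hc : c ≠ 0) (hR : Rel c t01 t02 t12 t11) {U V : Finset ℂ} {z w : ℂ}
    (hzU : z ∉ U) (hzV : z ∉ V) (hwU : w ∉ U) (hwV : w ∉ V) (hzw : z ≠ w)
    (hH : cH c U z ≠ 0)
    (u2 : RecU c l t01 t02 Φ U V z)
    (u3 : ∀ j ∈ U, RecU c l t01 t02 Φ (U.erase j) V z)
    (u4 : ∀ k ∈ V, RecU c l t01 t02 Φ U (insert w (V.erase k)) z)
    (v2 : ∀ k ∈ V, RecV c l t02 t12 Φ U (V.erase k) w)
    (v3 : ∀ k ∈ V, RecV c l t02 t12 Φ U (V.erase k) z)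
    (d1 : ActD c l t01 t11 Φ U V w) (d2 : ActD c l t01 t11 Φ U V z)
    (d3 : ∀ k ∈ V, ActD c l t01 t11 Φ U (V.erase k) w) :
    ActD c l t01 t11 Φ (insert z U) V w := by
  unfold RecV RecU ActD at *
  have zj : ∀ j ∈ U, z ≠ j := fun j hj h => hzU (h ▸ hj)
  have wj : ∀ j ∈ U, w ≠ j := fun j hj h => hwU (h ▸ hj)
  have zk : ∀ k ∈ V, z ≠ k := fun j hj h => hzV (h ▸ hj)
  have wk : ∀ k ∈ V, w ≠ k := fun j hj h => hwV (h ▸ hj)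
  have hJ : ff c z w • ∑ j ∈ U, (gg c w j * cP c l U j * cF c V j) •
        t01 z (t01 w (Φ (U.erase j) V))
      + gg c w z • ∑ j ∈ U, (gg c z j * cP c l U j * cF c V j) • t01 w (t01 z (Φ (U.erase j) V))
      = ∑ j ∈ U, (gg c w j * cP c l U j * gg c z j * cF c V j * hh c j z) •
          t01 w (t01 z (Φ (U.erase j) V)) := by
    simp only [Finset.smul_sum, ← Finset.sum_add_distrib]
    refine Finset.sum_congr rfl fun j hj => ?_
    have e := hh_mul_gg hc (zj j hj).symm
    have e1 := gg_three c (wj j hj) (zj j hj).symm hzw.symm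
    have e4 := hR.r0101 z w hzw (Φ (U.erase j) V)
    rw [smul_comm (ff c z w), e4, ff_eq c hzw.symm]
    rw [ff_eq c (zj j hj).symm] at e
    rw [gg_antisymm c j z]
    match_scalars
    linear_combination (cP c l U j * cF c V j) * (e1 + gg c w j * e)
  have hMK : ∑ k ∈ V, ∑ m ∈ V.erase k,
        ((gg c z k * cL c l U V k) * (gg c m w * cL c l U (V.erase k) m)) •
          t02 z (Φ U (insert w ((V.erase k).erase m)))
      = ∑ k ∈ V, ∑ m ∈ V.erase k,
        ((gg c k w * (ff c z k * cL c l U V k)) * (gg c z m * (cL c l U (V.erase k) m * ff c m w))) •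
          t02 z (Φ U (insert w ((V.erase k).erase m))) := by
    rw [← sub_eq_zero]
    simp only [← Finset.sum_sub_distrib]
    refine sum_symm_zero V _ fun k hk m hm hkm => ?_
    rw [Finset.erase_right_comm (a := m)]
    have hkm' : k ∈ V.erase m := Finset.mem_erase.2 ⟨hkm, hk⟩
    have hmk' : m ∈ V.erase k := Finset.mem_erase.2 ⟨hkm.symm, hm⟩
    have e := scal_km (c := c) hzw (zk k hk) (zk m hm) (wk k hk) (wk m hm) hkm
    have e1 : cL c l U V k = cL c l U (V.erase m) k * ff c k m := by
      conv_lhs => rw [← Finset.insert_erase hm]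
      exact cL_insert (by simp) hkm'
    have e2 : cL c l U V m = cL c l U (V.erase k) m * ff c m k := by
      conv_lhs => rw [← Finset.insert_erase hk]
      exact cL_insert (by simp) hmk'
    rw [e1, e2]
    match_scalars
    linear_combination (cL c l U (V.erase m) k * cL c l U (V.erase k) m) * e
  have hK : ff c z w • ∑ k ∈ V, (gg c k w * cL c l U V k) • t01 z (Φ U (insert w (V.erase k)))
      + gg c w z • ∑ k ∈ V, (gg c k z * cL c l U V k) • t01 w (Φ U (insert z (V.erase k)))
      + ∑ k ∈ V, (gg c z k * cL c l U V k) • t11 w (t02 z (Φ U (V.erase k)))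
      = ∑ k ∈ V, (l w * cF c V w * (ff c z w * cG c U w) * (gg c z k * cL c l U V k)) •
          t02 z (Φ U (V.erase k))
        + ∑ k ∈ V, (gg c k w * (ff c z k * cL c l U V k)) • t01 z (Φ U (insert w (V.erase k)))
        + ∑ k ∈ V, (gg c k w * (ff c z k * cL c l U V k) *
            (gg c z w * (l w * cF c (V.erase k) w * cG c U w))) • t02 z (Φ U (V.erase k))
        + ∑ k ∈ V, ∑ m ∈ V.erase k,
        ((gg c k w * (ff c z k * cL c l U V k)) * (gg c z m * (cL c l U (V.erase k) m * ff c m w))) •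
          t02 z (Φ U (insert w ((V.erase k).erase m)))
        + ∑ j ∈ U, ∑ k ∈ V, (gg c w j * cP c l U j * gg c z j * cF c V j * hh c j z *
            (gg c z k * cL c l (U.erase j) V k)) •
            t01 w (t02 z (Φ (U.erase j) (V.erase k))) := by
    rw [Finset.sum_comm (s := U), ← hMK]
    simp only [Finset.smul_sum, ← Finset.sum_add_distrib]
    refine Finset.sum_congr rfl fun k hk => ?_
    have e2 := gg_three c (zk k hk) (wk k hk).symm hzw
    have e3 : ∑ j ∈ U, (gg c w j * cP c l U j * gg c z j * cF c V j * hh c j z *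
            (gg c z k * cL c l (U.erase j) V k)) •
            t01 w (t02 z (Φ (U.erase j) (V.erase k)))
        = (gg c z k * cL c l U V k) • (
         ∑ j ∈ U, (gg c w j * cP c l U j * cF c (V.erase k) j) •
            t02 z (t01 w (Φ (U.erase j) (V.erase k)))
         - gg c z w • (∑ j ∈ U, (cP c l U j * cF c (V.erase k) j * gg c j w) •
            t01 z (t02 w (Φ (U.erase j) (V.erase k))))
         + gg c z w • ∑ j ∈ U, (cP c l U j * cF c (V.erase k) j * gg c j z) •
            t01 w (t02 z (Φ (U.erase j) (V.erase k)))) := by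
      simp only [Finset.smul_sum, ← Finset.sum_sub_distrib, ← Finset.sum_add_distrib]
      refine Finset.sum_congr rfl fun j hj => ?_
      have eX := scal_X hc hzw (zj j hj) (wj j hj)
      have eY := scal_Y hc hzw (zj j hj) (wj j hj)
      have e5 := cFL (c := c) (l := l) hj hk
      rw [hR.r0102 z w hzw, hR.r0102 w z hzw.symm]
      match_scalars
      · linear_combination (- cP c l U j * gg c z k * cL c l U V k * cF c (V.erase k) j) * eX
          - (gg c w j * cP c l U j * gg c z j * hh c j z * gg c z k * ff c z w) * e5
      · linear_combination (- cP c l U j * gg c z k * cL c l U V k * cF c (V.erase k) j) * eY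
          - (gg c w j * cP c l U j * gg c z j * hh c j z * gg c z k * gg c w z) * e5
    have e6 := v2 k hk
    have e7 := v3 k hk
    have e8 := d3 k hk
    have e9 : cF c V w = ff c w k * cF c (V.erase k) w := by
      unfold cF; rw [← Finset.mul_prod_erase V _ hk]
    have e10 : ∑ m ∈ V.erase k, ((gg c z k * cL c l U V k) * (gg c m w * cL c l U (V.erase k) m)) •
          t02 z (Φ U (insert w ((V.erase k).erase m)))
        = (gg c z k * cL c l U V k) • ∑ m ∈ V.erase k, (gg c m w * cL c l U (V.erase k) m) •
          t02 z (Φ U (insert w ((V.erase k).erase m))) := by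
      simp only [Finset.smul_sum, smul_smul]
    rw [e3, e10, hR.r1102 z w hzw, e8, e6, e7, e9, ff_eq c (wk k hk), ff_eq c hzw, ff_eq c (zk k hk),
      gg_antisymm c z k, gg_antisymm c z w, gg_antisymm c k w]
    simp only [map_add, map_sum, map_smul]
    match_scalars
    all_goals first
      | ring1
      | linear_combination (cL c l U V k) * e2
      | linear_combination -(cL c l U V k) * e2
      | linear_combination (cL c l U V k * l w * cF c (V.erase k) w * cG c U w * (1 + gg c z k)) * e2
      | linear_combination -(cL c l U V k * l w * cF c (V.erase k) w * cG c U w * (1 + gg c z k)) * e2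
      | linear_combination (cL c l U V k * l w * cF c (V.erase k) w * cG c U w) * e2
      | linear_combination -(cL c l U V k * l w * cF c (V.erase k) w * cG c U w) * e2
      | skip
  have hwzj : ∀ j ∈ U, cH c U z • t01 w (Φ (insert z (U.erase j)) V)
      = hh c j z • (t01 w (t01 z (Φ (U.erase j) V))
        + ∑ k ∈ V, (gg c z k * cL c l (U.erase j) V k) •
            t01 w (t02 z (Φ (U.erase j) (V.erase k)))) := by
    intro j hj
    rw [cH_erase hj, mul_smul, ← map_smul, u3 j hj]
    simp only [map_add, map_sum, map_smul]
  have hrhs : cH c U z • ∑ j ∈ insert z U,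
        (gg c w j * cP c l (insert z U) j * cF c V j) • t01 w (Φ ((insert z U).erase j) V)
      = (gg c w z * (l z * cG c U z) * cF c V z) • t01 w (Φ U V)
        + ∑ j ∈ U, (gg c w j * cP c l U j * gg c z j * cF c V j * hh c j z) •
          t01 w (t01 z (Φ (U.erase j) V))
        + ∑ j ∈ U, ∑ k ∈ V, (gg c w j * cP c l U j * gg c z j * cF c V j * hh c j z *
            (gg c z k * cL c l (U.erase j) V k)) •
            t01 w (t02 z (Φ (U.erase j) (V.erase k))) := by
    rw [Finset.sum_insert hzU, Finset.erase_insert hzU, smul_add, add_assoc]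
    congr 1
    · rw [smul_smul, ← cH_P hc hzU]
      congr 1; ring
    · rw [← Finset.sum_add_distrib, Finset.smul_sum]
      refine Finset.sum_congr rfl fun j hj => ?_
      rw [Finset.erase_insert_of_ne (zj j hj), smul_comm, hwzj j hj, cP_insert hzU hj]
      simp only [smul_add, Finset.smul_sum, smul_smul]
      congr 1
      · congr 1; ring
      · refine Finset.sum_congr rfl fun k _ => ?_
        congr 1; ring
  have hmid : cH c U z • ∑ k ∈ V, (gg c k w * cL c l (insert z U) V k) •
        Φ (insert z U) (insert w (V.erase k))
      = ∑ k ∈ V, (gg c k w * (ff c z k * cL c l U V k)) • t01 z (Φ U (insert w (V.erase k)))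
        + ∑ k ∈ V, (gg c k w * (ff c z k * cL c l U V k) *
            (gg c z w * (l w * cF c (V.erase k) w * cG c U w))) • t02 z (Φ U (V.erase k))
        + ∑ k ∈ V, ∑ m ∈ V.erase k,
        ((gg c k w * (ff c z k * cL c l U V k)) * (gg c z m * (cL c l U (V.erase k) m * ff c m w))) •
          t02 z (Φ U (insert w ((V.erase k).erase m))) := by
    simp only [Finset.smul_sum, ← Finset.sum_add_distrib]
    refine Finset.sum_congr rfl fun k hk => ?_
    have hwk : w ∉ V.erase k := by simp [hwV]
    rw [smul_comm, u4 k hk, cL_insert_left hzU, Finset.sum_insert hwk, Finset.erase_insert hwk,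
      cL_insert_self hwk]
    have : ∑ m ∈ V.erase k, (gg c z m * cL c l U (insert w (V.erase k)) m) •
          t02 z (Φ U ((insert w (V.erase k)).erase m))
        = ∑ m ∈ V.erase k, (gg c z m * (cL c l U (V.erase k) m * ff c m w)) •
          t02 z (Φ U (insert w ((V.erase k).erase m))) := by
      refine Finset.sum_congr rfl fun m hm => ?_
      rw [cL_insert hwk hm, Finset.erase_insert_of_ne (wk m (Finset.mem_of_mem_erase hm))]
    rw [this]
    simp only [smul_add, Finset.smul_sum, smul_smul, add_assoc]
  have hG : cG c (insert z U) w = ff c z w * cG c U w := by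
    unfold cG; rw [Finset.prod_insert hzU]
  have hfst : cH c U z • (l w * cF c V w * cG c (insert z U) w) • Φ (insert z U) V
      = (l w * cF c V w * (ff c z w * cG c U w)) • t01 z (Φ U V)
        + ∑ k ∈ V, (l w * cF c V w * (ff c z w * cG c U w) * (gg c z k * cL c l U V k)) •
          t02 z (Φ U (V.erase k)) := by
    rw [smul_comm, u2, hG]
    simp only [smul_add, Finset.smul_sum, smul_smul]
  refine smul_right_injective M hH ?_
  change cH c U z • _ = cH c U z • _
  rw [smul_add, smul_add, hrhs, hmid, hfst, ← map_smul, u2, map_add, hR.r1101 z w hzw, d1, d2]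
  simp only [map_add, map_sum, map_smul]
  linear_combination (norm := module) hJ + hK

end

section
variable {M : Type*} [AddCommGroup M] [Module ℂ M]
variable {c : ℂ} {l : ℂ → ℂ} {t01 t02 t12 t11 : ℂ → M →ₗ[ℂ] M} {Φ : Finset ℂ → Finset ℂ → M}

theorem actD_base (hR : Rel c t01 t02 t12 t11)
    (hb : ∀ V w, w ∉ V → Φ ∅ (insert w V) = t12 w (Φ ∅ V))
    (h0 : ∀ w, t11 w (Φ ∅ ∅) = l w • Φ ∅ ∅) (V : Finset ℂ) :
    ∀ w, w ∉ V → ActD c l t01 t11 Φ ∅ V w := by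
  induction V using Finset.induction_on with
  | empty => intro w _; simp [ActD, cF, cG, h0]
  | insert z V hz ih =>
    intro w hw
    simp only [Finset.mem_insert, not_or] at hw
    have h1 := ih w hw.2
    have h2 := ih z hz
    unfold ActD at *
    simp only [Finset.sum_empty, add_zero] at *
    rw [hb V z hz, hR.r1112 z w (Ne.symm hw.1), h1, h2, Finset.sum_insert hz,
      Finset.erase_insert hz, cL_insert_self hz, hb V w hw.2]
    have e : ∑ k ∈ V, (gg c k w * cL c l ∅ (insert z V) k) • Φ ∅ (insert w ((insert z V).erase k))
        = ∑ k ∈ V, (ff c w z * (gg c k w * cL c l ∅ V k)) • t12 z (Φ ∅ (insert w (V.erase k)))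
        + ∑ k ∈ V, (gg c z w * (gg c k z * cL c l ∅ V k)) • t12 w (Φ ∅ (insert z (V.erase k))) := by
      rw [← Finset.sum_add_distrib]
      refine Finset.sum_congr rfl fun k hk => ?_
      have zk : z ≠ k := fun h => hz (h ▸ hk)
      have wk : w ≠ k := fun h => hw.2 (h ▸ hk)
      rw [cL_insert hz hk, Finset.erase_insert_of_ne zk, hb _ w (by simp [hw.1, hw.2]),
        hb _ w (by simp [hw.2]), hb _ z (by simp [hz]), hR.r1212 z w (Ne.symm hw.1), ← add_smul]
      congr 1
      have a1 : k - z ≠ 0 := sub_ne_zero.2 (Ne.symm zk)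
      have a2 : k - w ≠ 0 := sub_ne_zero.2 (Ne.symm wk)
      have a3 : w - z ≠ 0 := sub_ne_zero.2 hw.1
      have a4 : z - w ≠ 0 := sub_ne_zero.2 (Ne.symm hw.1)
      unfold gg ff
      rw [← neg_sub w z]
      field_simp
      ring
    rw [e]
    simp only [map_add, map_sum, map_smul, smul_add, Finset.smul_sum, smul_smul]
    have e2 : cF c (insert z V) w = ff c w z * cF c V w := by
      unfold cF; rw [Finset.prod_insert hz]
    rw [e2]
    simp only [cG, Finset.prod_empty, mul_one]
    module

theorem joint (hc : c ≠ 0) (hR : Rel c t01 t02 t12 t11) (W : Finset ℂ)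
    (hW : ∀ x ∈ W, ∀ y ∈ W, x ≠ y → x - y + c ≠ 0)
    (hb : ∀ V w, w ∉ V → Φ ∅ (insert w V) = t12 w (Φ ∅ V))
    (h0 : ∀ w, t11 w (Φ ∅ ∅) = l w • Φ ∅ ∅)
    (hU : ∀ U V z, U ⊆ W → V ⊆ W → z ∈ W → Disjoint U V → z ∉ U → z ∉ V →
      RecU c l t01 t02 Φ U V z)
    (U : Finset ℂ) (hUW : U ⊆ W) : ∀ V w, V ⊆ W → w ∈ W → Disjoint U V → w ∉ U → w ∉ V →
      RecV c l t02 t12 Φ U V w ∧ ActD c l t01 t11 Φ U V w := by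
  induction U using Finset.induction_on with
  | empty =>
    intro V w _ _ _ _ hw
    refine ⟨?_, actD_base hR hb h0 V w hw⟩
    simp [RecV, hb V w hw]
  | insert z U hzU ih =>
    intro V w hVW hwW hd hw hwV
    have hzW : z ∈ W := hUW (by simp)
    have hUW' : U ⊆ W := fun x hx => hUW (by simp [hx])
    rw [Finset.disjoint_insert_left] at hd
    obtain ⟨hzV, hd⟩ := hd
    simp only [Finset.mem_insert, not_or] at hw
    have ih := ih hUW'
    have hH : cH c U z ≠ 0 := by
      unfold cH
      refine Finset.prod_ne_zero_iff.2 fun x hx => ?_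
      exact div_ne_zero (hW x (hUW' hx) z hzW (fun h => hzU (h ▸ hx))) hc
    have sV : ∀ k, V.erase k ⊆ W := fun k => (Finset.erase_subset _ _).trans hVW
    have sU : ∀ k, U.erase k ⊆ W := fun k => (Finset.erase_subset _ _).trans hUW'
    have dV : ∀ k, Disjoint U (V.erase k) := fun k => hd.mono_right (Finset.erase_subset _ _)
    have dU : ∀ k, Disjoint (U.erase k) V := fun k => hd.mono_left (Finset.erase_subset _ _)
    have zw : z ≠ w := Ne.symm hw.1
    have iV : ∀ V', V' ⊆ W → insert w V' ⊆ W := fun V' h => Finset.insert_subset hwW h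
    have u2 : RecU c l t01 t02 Φ U V z := hU U V z hUW' hVW hzW hd hzU hzV
    have u3 : ∀ j ∈ U, RecU c l t01 t02 Φ (U.erase j) V z := fun j _ =>
      hU _ V z (sU j) hVW hzW (dU j) (by simp [hzU]) hzV
    have v2 : ∀ k ∈ V, RecV c l t02 t12 Φ U (V.erase k) w := fun k _ =>
      (ih _ w (sV k) hwW (dV k) hw.2 (by simp [hwV])).1
    have v3 : ∀ k ∈ V, RecV c l t02 t12 Φ U (V.erase k) z := fun k _ =>
      (ih _ z (sV k) hzW (dV k) hzU (by simp [hzV])).1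
    have i1 := ih V w hVW hwW hd hw.2 hwV
    have i2 := ih V z hVW hzW hd hzU hzV
    constructor
    · refine recV_step hc hR hzU hzV hw.2 hwV zw hH ?_ u2 u3 i1.1 v2 v3 i1.2 i2.2
      exact hU U _ z hUW' (iV _ hVW) hzW (by simp [hw.2, hd]) hzU (by simp [zw, hzV])
    · refine actD_step hc hR hzU hzV hw.2 hwV zw hH u2 u3 ?_ v2 v3 i1.2 i2.2 ?_
      · intro k _
        exact hU U _ z hUW' (iV _ (sV k)) hzW (by simp [hw.2, dV k]) hzU (by simp [zw, hzV])
      · intro k _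
        exact (ih _ w (sV k) hwW (dV k) hw.2 (by simp [hwV])).2
end

theorem prod_if_Iio {n : ℕ} (F : Fin n → Fin n → ℂ) :
    (∏ j : Fin n, ∏ k : Fin n, if (k : ℕ) < (j : ℕ) then F k j else 1)
      = ∏ j, ∏ k ∈ Finset.Iio j, F k j := by
  refine Finset.prod_congr rfl fun j _ => ?_
  rw [← Finset.prod_filter]
  refine Finset.prod_congr ?_ fun _ _ => rfl
  ext k; simp

theorem Kiz_perm_left (c : ℂ) {n : ℕ} (vs us : Fin n → ℂ) (σ : Equiv.Perm (Fin n)) :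
    Kiz c (fun i => vs (σ i)) us = Kiz c vs us := by
  unfold Kiz
  rw [prod_if_Iio (fun k j => gg c (vs (σ j)) (vs (σ k))), prod_if_Iio (fun k j => gg c (vs j) (vs k)),
    Equiv.Perm.prod_Iio_comp_eq_sign_mul_prod σ (f := fun k j => gg c (vs j) (vs k))
      (fun i j => gg_antisymm c _ _)]
  have h1 : (∏ j, ∏ k, hh c (vs (σ j)) (us k)) = ∏ j, ∏ k, hh c (vs j) (us k) :=
    Equiv.prod_comp σ (fun j => ∏ k, hh c (vs j) (us k))
  have h2 := Matrix.det_permute σ (Matrix.of fun j k => gg c (vs j) (us k) / hh c (vs j) (us k))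
  have h3 : ((Matrix.of fun j k => gg c (vs j) (us k) / hh c (vs j) (us k)).submatrix σ id)
    = Matrix.of fun j k => gg c (vs (σ j)) (us k) / hh c (vs (σ j)) (us k) := by
    ext; simp
  rw [h3] at h2
  rw [h1, h2]
  have h4 : (((Equiv.Perm.sign σ : ℤˣ) : ℤ) : ℂ) * (((Equiv.Perm.sign σ : ℤˣ) : ℤ) : ℂ) = 1 := by
    rcases Int.units_eq_one_or (Equiv.Perm.sign σ) with h | h <;> simp [h]
  generalize (((Equiv.Perm.sign σ : ℤˣ) : ℤ) : ℂ) = s at *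
  generalize Matrix.det (n := Fin n) (R := ℂ) _ = d
  generalize (∏ j, ∏ k ∈ Finset.Iio j, gg c (vs j) (vs k)) = x
  linear_combination (x * (∏ j : Fin n, ∏ k : Fin n, if (k : ℕ) < (j : ℕ) then gg c (us k) (us j) else 1) * (∏ j, ∏ k, hh c (vs j) (us k)) * d) * h4

theorem Kiz_perm_right (c : ℂ) {n : ℕ} (vs us : Fin n → ℂ) (σ : Equiv.Perm (Fin n)) :
    Kiz c vs (fun i => us (σ i)) = Kiz c vs us := by
  unfold Kiz
  rw [prod_if_Iio (fun k j => gg c (us (σ k)) (us (σ j))), prod_if_Iio (fun k j => gg c (us k) (us j)),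
    Equiv.Perm.prod_Iio_comp_eq_sign_mul_prod σ (f := fun k j => gg c (us k) (us j))
      (fun i j => gg_antisymm c _ _)]
  have h1 : (∏ j, ∏ k, hh c (vs j) (us (σ k))) = ∏ j, ∏ k, hh c (vs j) (us k) :=
    Finset.prod_congr rfl fun j _ => Equiv.prod_comp σ (fun k => hh c (vs j) (us k))
  have h2 := Matrix.det_permute' σ (Matrix.of fun j k => gg c (vs j) (us k) / hh c (vs j) (us k))
  have h3 : ((Matrix.of fun j k => gg c (vs j) (us k) / hh c (vs j) (us k)).submatrix id σ)
    = Matrix.of fun j k => gg c (vs j) (us (σ k)) / hh c (vs j) (us (σ k)) := by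
    ext; simp
  rw [h3] at h2
  rw [h1, h2]
  have h4 : (((Equiv.Perm.sign σ : ℤˣ) : ℤ) : ℂ) * (((Equiv.Perm.sign σ : ℤˣ) : ℤ) : ℂ) = 1 := by
    rcases Int.units_eq_one_or (Equiv.Perm.sign σ) with h | h <;> simp [h]
  generalize (((Equiv.Perm.sign σ : ℤˣ) : ℤ) : ℂ) = s at *
  generalize Matrix.det (n := Fin n) (R := ℂ) _ = d
  generalize (∏ j, ∏ k ∈ Finset.Iio j, gg c (us k) (us j)) = x
  linear_combination (x * (∏ j : Fin n, ∏ k : Fin n, if (k : ℕ) < (j : ℕ) then gg c (vs j) (vs k) else 1) * (∏ j, ∏ k, hh c (vs j) (us k)) * d) * h4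

theorem exists_perm {n : ℕ} {a b : Fin n → ℂ} (ha : Function.Injective a)
    (h : ∀ i, ∃ j, b j = a i) : ∃ σ : Equiv.Perm (Fin n), a = fun i => b (σ i) := by
  choose s hs using h
  have hi : Function.Injective s := fun i j hij => ha (by rw [← hs i, ← hs j, hij])
  refine ⟨Equiv.ofBijective s (Finite.injective_iff_bijective.1 hi), ?_⟩
  funext i
  exact (hs i).symm

/-- kernel as a function of finite sets -/
def KF (c : ℂ) (S Q : Finset ℂ) : ℂ := KizL c S.toList Q.toList

theorem KF_zero (c : ℂ) {S Q : Finset ℂ} (h : S.card ≠ Q.card) : KF c S Q = 0 := by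
  unfold KF KizL
  rw [dif_neg]
  simpa using h

theorem KF_eq (c : ℂ) {S Q : Finset ℂ} {n : ℕ} {a b : Fin n → ℂ} (ha : Function.Injective a)
    (hb : Function.Injective b) (hS : Finset.univ.image a = S) (hQ : Finset.univ.image b = Q) :
    KF c S Q = Kiz c a b := by
  have h1 : S.toList.length = n := by
    rw [Finset.length_toList, ← hS, Finset.card_image_of_injective _ ha]; simp
  have h2 : Q.toList.length = n := by
    rw [Finset.length_toList, ← hQ, Finset.card_image_of_injective _ hb]; simp
  subst h1
  unfold KF KizL
  rw [dif_pos h2.symm]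
  obtain ⟨σ, hσ⟩ := exists_perm (b := S.toList.get) ha (fun i => by
    have : a i ∈ S.toList := by rw [Finset.mem_toList, ← hS]; simp
    obtain ⟨j, hj⟩ := List.get_of_mem this
    exact ⟨j, hj⟩)
  obtain ⟨τ, hτ⟩ := exists_perm (b := fun j => Q.toList.get (Fin.cast h2.symm j)) hb (fun i => by
    have : b i ∈ Q.toList := by rw [Finset.mem_toList, ← hQ]; simp
    obtain ⟨j, hj⟩ := List.get_of_mem this
    exact ⟨Fin.cast h2 j, hj⟩)
  rw [hσ, Kiz_perm_left]
  rw [hτ]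
  exact (Kiz_perm_right c _ (fun j => Q.toList.get (Fin.cast h2.symm j)) τ).symm

theorem KizL_eq_KF (c : ℂ) {xs ys : List ℂ} (hx : xs.Nodup) (hy : ys.Nodup) :
    KizL c xs ys = KF c xs.toFinset ys.toFinset := by
  by_cases h : xs.length = ys.length
  · rw [KF_eq c (a := xs.get) (b := fun j => ys.get (Fin.cast h j))]
    · unfold KizL; rw [dif_pos h]
    · exact List.nodup_iff_injective_get.1 hx
    · exact (List.nodup_iff_injective_get.1 hy).comp (Fin.cast_injective h)
    · ext x
      simp only [Finset.mem_image, Finset.mem_univ, true_and, List.mem_toFinset, List.mem_iff_get]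
    · ext x
      simp only [Finset.mem_image, Finset.mem_univ, true_and, List.mem_toFinset, List.mem_iff_get]
      constructor
      · rintro ⟨j, hj⟩; exact ⟨_, hj⟩
      · rintro ⟨j, hj⟩; exact ⟨Fin.cast h.symm j, hj⟩
  · rw [KF_zero]
    · unfold KizL; rw [dif_neg h]
    · rwa [List.toFinset_card_of_nodup hx, List.toFinset_card_of_nodup hy]

open Polynomial in
/-- interpolation identity -/
theorem interp (c : ℂ) (hc : c ≠ 0) {n : ℕ} (u : Fin n → ℂ) (v : Fin (n + 1) → ℂ) (κ : Fin (n + 1) → ℂ)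
    (hu : Function.Injective u) (hv : Function.Injective v) (huv : ∀ i j, u i ≠ v j)
    (hE : ∀ i, ∑ k, κ k * gg c (u i) (v k) * ∏ m, hh c (u i) (v (k.succAbove m)) = 0)
    (z : ℂ) (hzv : ∀ j, z ≠ v j) (hzu : ∀ j, z ≠ u j) :
    (∏ j, gg c (u j) z) * ∑ k, κ k * gg c z (v k) * ∏ m, hh c z (v (k.succAbove m))
      = ∑ k, κ k * gg c z (v k) * (∏ m, hh c (v k) (v (k.succAbove m))) * ∏ j, gg c (u j) (v k) := by
  let P : ℂ[X] := ∑ k, C (κ k) * ∏ m, ((C c⁻¹ * (Polynomial.X + C (c - v (k.succAbove m)))) *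
    (Polynomial.X - C (v (k.succAbove m))))
  let Q : ℂ[X] := ∑ k, C (κ k) * (∏ m, (C (hh c (v k) (v (k.succAbove m))) *
    (Polynomial.X - C (v (k.succAbove m))))) * ∏ j, (C (u j - v k)⁻¹ * (C (u j) - Polynomial.X))
  have eP : ∀ x, P.eval x = ∑ k, κ k * ∏ m, (hh c x (v (k.succAbove m)) * (x - v (k.succAbove m))) := by
    intro x
    simp only [P, eval_finsetSum, eval_mul, eval_C, eval_prod, eval_add, eval_sub, eval_X, hh]
    refine Finset.sum_congr rfl fun k _ => ?_
    congr 1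
    refine Finset.prod_congr rfl fun m _ => ?_
    ring
  have eQ : ∀ x, Q.eval x = ∑ k, κ k * (∏ m, (hh c (v k) (v (k.succAbove m)) *
      (x - v (k.succAbove m)))) * ∏ j, ((u j - x) * (u j - v k)⁻¹) := by
    intro x
    simp only [Q, eval_finsetSum, eval_mul, eval_C, eval_prod, eval_sub, eval_X]
    refine Finset.sum_congr rfl fun k _ => ?_
    congr 1
    refine Finset.prod_congr rfl fun m _ => ?_
    ring
  have full : ∀ (x : ℂ) (k : Fin (n+1)), x ≠ v k →
      ∏ m, (x - v (Fin.succAbove k m)) = (∏ m, (x - v m)) * c⁻¹ * gg c x (v k) := by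
    intro x k hx
    rw [Fin.prod_univ_succAbove _ k]
    have := sub_ne_zero.2 hx
    unfold gg
    field_simp
  have zero : ∀ i k : Fin (n+1), k ≠ i → ∏ m, (v i - v (Fin.succAbove k m)) = 0 := by
    intro i k hik
    obtain ⟨m, hm⟩ := Fin.exists_succAbove_eq (Ne.symm hik)
    exact Finset.prod_eq_zero (Finset.mem_univ m) (by rw [hm, sub_self])
  have key : P = Q := by
    refine Polynomial.eq_of_natDegree_lt_card_of_eval_eq P Q (f := Sum.elim v u) ?_ ?_ ?_
    · rintro (i | i) (j | j) h
      · simp only [Sum.elim_inl] at h; rw [hv h]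
      · exact absurd h.symm (huv j i)
      · exact absurd h (huv i j)
      · simp only [Sum.elim_inr] at h; rw [hu h]
    · rintro (i | i)
      · simp only [Sum.elim_inl]
        rw [eP, eQ]
        refine Finset.sum_congr rfl fun k _ => ?_
        simp only [Finset.prod_mul_distrib]
        by_cases hk : k = i
        · subst hk
          rw [← Finset.prod_mul_distrib (f := fun j => u j - v k), Finset.prod_eq_one (s := Finset.univ)
            (f := fun j => (u j - v k) * (u j - v k)⁻¹), mul_one]
          intro j _
          exact mul_inv_cancel₀ (sub_ne_zero.2 (huv j k))
        · rw [zero i k hk]; ring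
      · simp only [Sum.elim_inr]
        rw [eP, eQ]
        trans (0 : ℂ)
        · have := hE i
          simp only [Finset.prod_mul_distrib]
          calc _ = (∏ m, (u i - v m)) * c⁻¹ * ∑ k, κ k * gg c (u i) (v k) * ∏ m, hh c (u i) (v (k.succAbove m)) := by
                rw [Finset.mul_sum]
                refine Finset.sum_congr rfl fun k _ => ?_
                rw [full _ _ (huv i k)]; ring
            _ = 0 := by rw [this, mul_zero]
        · symm
          refine Finset.sum_eq_zero fun k _ => ?_
          rw [Finset.prod_eq_zero (s := Finset.univ) (f := fun j => (u j - u i) * (u j - v k)⁻¹)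
            (Finset.mem_univ i) (by simp), mul_zero]
    · have d1 : P.natDegree ≤ 2 * n := by
        refine natDegree_sum_le_of_forall_le _ _ fun k _ => ?_
        refine (natDegree_C_mul_le _ _).trans ((natDegree_prod_le _ _).trans ?_)
        calc _ ≤ ∑ m : Fin n, 2 := by
              refine Finset.sum_le_sum fun m _ => ?_
              compute_degree
          _ = 2 * n := by simp [mul_comm]
      have d2 : Q.natDegree ≤ 2 * n := by
        refine natDegree_sum_le_of_forall_le _ _ fun k _ => ?_
        refine natDegree_mul_le.trans ?_
        have a1 : (C (κ k) * (∏ m, (C (hh c (v k) (v (k.succAbove m))) *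
            (Polynomial.X - C (v (k.succAbove m)))))).natDegree ≤ n := by
          refine (natDegree_C_mul_le _ _).trans ((natDegree_prod_le _ _).trans ?_)
          calc _ ≤ ∑ m : Fin n, 1 := by
                refine Finset.sum_le_sum fun m _ => ?_
                compute_degree
            _ = n := by simp
        have a2 : (∏ j, (C (u j - v k)⁻¹ * (C (u j) - Polynomial.X)) : ℂ[X]).natDegree ≤ n := by
          refine (natDegree_prod_le _ _).trans ?_
          calc _ ≤ ∑ m : Fin n, 1 := by
                refine Finset.sum_le_sum fun m _ => ?_
                compute_degree
            _ = n := by simp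
        omega
      simp only [Fintype.card_sum, Fintype.card_fin]
      omega
  have hz : P.eval z = Q.eval z := by rw [key]
  rw [eP, eQ] at hz
  simp only [Finset.prod_mul_distrib] at hz
  have hz1 : (∏ m, (z - v m)) * c⁻¹ * ∑ k, κ k * gg c z (v k) * ∏ m, hh c z (v (k.succAbove m))
      = (∏ m, (z - v m)) * c⁻¹ * ((∏ j, (u j - z)) * ∑ k, κ k * gg c z (v k) * (∏ m, hh c (v k) (v (k.succAbove m))) * ∏ j, (u j - v k)⁻¹) := by
    rw [Finset.mul_sum, Finset.mul_sum, Finset.mul_sum]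
    calc _ = _ := ?_
      _ = _ := hz
      _ = _ := ?_
    · refine Finset.sum_congr rfl fun k _ => ?_
      rw [full _ _ (hzv k)]; ring
    · refine Finset.sum_congr rfl fun k _ => ?_
      rw [full _ _ (hzv k)]; ring
  have hne : (∏ m, (z - v m)) * c⁻¹ ≠ 0 :=
    mul_ne_zero (Finset.prod_ne_zero_iff.2 fun m _ => sub_ne_zero.2 (hzv m)) (inv_ne_zero hc)
  rw [mul_left_cancel₀ hne hz1, ← mul_assoc, ← Finset.prod_mul_distrib, Finset.mul_sum]
  refine Finset.sum_congr rfl fun k _ => ?_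
  have : ∀ j, gg c (u j) z * (u j - z) = c := fun j => by
    have := sub_ne_zero.2 (Ne.symm (hzu j))
    unfold gg; field_simp
  simp only [this]
  have : ∏ j, gg c (u j) (v k) = (∏ j : Fin n, c) * ∏ j, (u j - v k)⁻¹ := by
    rw [← Finset.prod_mul_distrib]; rfl
  rw [this]; ring

theorem prod_sign {n : ℕ} (k : Fin (n + 1)) :
    (∏ m : Fin n, if (k.succAbove m : ℕ) < (k : ℕ) then (-1 : ℂ) else 1) = (-1) ^ (k : ℕ) := by
  rw [← Finset.prod_filter, Finset.prod_const]
  congr 1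
  have : (Finset.univ.filter fun m : Fin n => (k.succAbove m : ℕ) < (k : ℕ))
      = Finset.univ.filter fun m : Fin n => (m : ℕ) < (k : ℕ) := by
    ext m
    have := Fin.succAbove_lt_iff_castSucc_lt k m
    simp only [Finset.mem_filter, Finset.mem_univ, true_and]
    rw [← Fin.lt_def, this, Fin.lt_def, Fin.val_castSucc]
  rw [this]
  have hk : (k : ℕ) ≤ n := Nat.lt_succ_iff.1 k.2
  rw [Fin.card_filter_val_lt]
  omega

theorem prod_D_succAbove (c : ℂ) {n : ℕ} (v : Fin (n + 1) → ℂ) (k : Fin (n + 1)) :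
    (∏ j : Fin (n + 1), ∏ i : Fin (n + 1), if (i : ℕ) < (j : ℕ) then gg c (v i) (v j) else 1)
      = (-1) ^ (k : ℕ) * (∏ m, gg c (v k) (v (k.succAbove m))) *
        ∏ j : Fin n, ∏ i : Fin n, if (i : ℕ) < (j : ℕ) then
          gg c (v (k.succAbove i)) (v (k.succAbove j)) else 1 := by
  rw [Fin.prod_univ_succAbove _ k, Fin.prod_univ_succAbove _ k, if_neg (lt_irrefl _), one_mul]
  have h1 : ∀ j : Fin n, (∏ i : Fin (n+1), if (i : ℕ) < (k.succAbove j : ℕ) then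
        gg c (v i) (v (k.succAbove j)) else 1)
      = (if (k : ℕ) < (k.succAbove j : ℕ) then gg c (v k) (v (k.succAbove j)) else 1) *
        ∏ i : Fin n, if (i : ℕ) < (j : ℕ) then
          gg c (v (k.succAbove i)) (v (k.succAbove j)) else 1 := by
    intro j
    rw [Fin.prod_univ_succAbove _ k]
    congr 1
    refine Finset.prod_congr rfl fun i _ => ?_
    have : ((k.succAbove i : ℕ) < (k.succAbove j : ℕ)) ↔ (i : ℕ) < (j : ℕ) := by
      rw [← Fin.lt_def, ← Fin.lt_def]; exact Fin.succAbove_lt_succAbove_iff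
    simp only [this]
  simp only [h1]
  rw [Finset.prod_mul_distrib, ← mul_assoc, ← prod_sign k, ← Finset.prod_mul_distrib,
    ← Finset.prod_mul_distrib, ← Finset.prod_mul_distrib, ← Finset.prod_mul_distrib]
  refine Finset.prod_congr rfl fun m _ => ?_
  congr 1
  have hne : (k.succAbove m : ℕ) ≠ (k : ℕ) := fun h => Fin.succAbove_ne k m (Fin.ext h)
  by_cases h : (k.succAbove m : ℕ) < (k : ℕ)
  · rw [if_pos h, if_neg (by omega), if_pos h, gg_antisymm c (v k)]; ring
  · rw [if_neg h, if_pos (by omega), if_neg h]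

/-- auxiliary coefficient in the row expansion -/
def kap (c : ℂ) {n : ℕ} (u : Fin n → ℂ) (v : Fin (n + 1) → ℂ) (k : Fin (n + 1)) : ℂ :=
  (∏ m, gg c (v k) (v (k.succAbove m))) * (∏ j, hh c (u j) (v k)) *
    Kiz c u (fun m => v (k.succAbove m))

theorem kap_sum (c : ℂ) {n : ℕ} (u : Fin n → ℂ) (v : Fin (n + 1) → ℂ) (z : ℂ)
    (hz : ∀ k, hh c z (v k) ≠ 0) :
    ∑ k, kap c u v k * gg c z (v k) * ∏ m, hh c z (v (k.succAbove m))
      = (∏ j : Fin n, ∏ k : Fin n, if (k : ℕ) < (j : ℕ) then gg c (u j) (u k) else 1) *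
        (∏ j : Fin (n + 1), ∏ i : Fin (n + 1), if (i : ℕ) < (j : ℕ) then gg c (v i) (v j) else 1) *
        (∏ j, ∏ k, hh c (u j) (v k)) * (∏ k, hh c z (v k)) *
        Matrix.det (Matrix.of fun (j k : Fin (n + 1)) =>
          gg c ((Fin.cons z u : Fin (n + 1) → ℂ) j) (v k) /
          hh c ((Fin.cons z u : Fin (n + 1) → ℂ) j) (v k)) := by
  rw [Matrix.det_succ_row_zero, Finset.mul_sum]
  refine Finset.sum_congr rfl fun k _ => ?_
  rw [prod_D_succAbove c v k]
  have h1 : (∏ j, ∏ k, hh c (u j) (v k)) = (∏ j, hh c (u j) (v k)) *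
      ∏ j, ∏ m, hh c (u j) (v (k.succAbove m)) := by
    rw [← Finset.prod_mul_distrib]
    exact Finset.prod_congr rfl fun j _ => Fin.prod_univ_succAbove _ k
  have h2 : (∏ k, hh c z (v k)) = hh c z (v k) * ∏ m, hh c z (v (k.succAbove m)) :=
    Fin.prod_univ_succAbove _ k
  have h3 : ((Matrix.of fun (j k : Fin (n + 1)) =>
          gg c ((Fin.cons z u : Fin (n + 1) → ℂ) j) (v k) /
          hh c ((Fin.cons z u : Fin (n + 1) → ℂ) j) (v k)).submatrix Fin.succ k.succAbove)
      = Matrix.of fun j m => gg c (u j) (v (k.succAbove m)) / hh c (u j) (v (k.succAbove m)) := by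
    ext; simp
  rw [h1, h2, h3]
  unfold kap Kiz
  simp only [Matrix.of_apply, Fin.cons_zero]
  have h4 : ((-1 : ℂ) ^ (k : ℕ)) * (-1) ^ (k : ℕ) = 1 := by
    rw [← mul_pow]; simp
  have h5 : hh c z (v k) * (gg c z (v k) / hh c z (v k)) = gg c z (v k) := by
    field_simp [hz k]
  generalize hd : Matrix.det (n := Fin n) (R := ℂ) _ = d
  generalize (∏ j : Fin n, ∏ i : Fin n, if (i : ℕ) < (j : ℕ) then
          gg c (v (k.succAbove i)) (v (k.succAbove j)) else 1) = D
  generalize (∏ m, gg c (v k) (v (k.succAbove m))) = D2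
  generalize (∏ j : Fin n, ∏ k : Fin n, if (k : ℕ) < (j : ℕ) then gg c (u j) (u k) else 1) = D3
  generalize (∏ j, ∏ m, hh c (u j) (v (k.succAbove m))) = D4
  generalize (∏ m, hh c z (v (k.succAbove m))) = D5
  generalize (∏ j, hh c (u j) (v k)) = D6
  generalize (-1 : ℂ) ^ (k : ℕ) = s at *
  generalize gg c z (v k) / hh c z (v k) = q at *
  rw [← h5]
  linear_combination (-(D2 * D6 * D3 * D * D4 * d * D5 * hh c z (v k) * q)) * h4

theorem Kiz_cons (c : ℂ) (hc : c ≠ 0) {n : ℕ} (u : Fin n → ℂ) (v : Fin (n + 1) → ℂ) (z : ℂ)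
    (hz : ∀ k, z - v k + c ≠ 0) (hu : ∀ j k, u j - v k + c ≠ 0)
    (hui : Function.Injective u) (hvi : Function.Injective v) (huv : ∀ i j, u i ≠ v j)
    (hzv : ∀ j, z ≠ v j) (hzu : ∀ j, z ≠ u j) :
    Kiz c (Fin.cons z u : Fin (n + 1) → ℂ) v
      = ∑ k, gg c z (v k) * (∏ m, ff c (v k) (v (k.succAbove m))) * (∏ j, ff c (u j) (v k)) *
        Kiz c u (fun m => v (k.succAbove m)) := by
  have e1 : Kiz c (Fin.cons z u : Fin (n + 1) → ℂ) v
      = (∏ j, gg c (u j) z) * ∑ k, kap c u v k * gg c z (v k) * ∏ m, hh c z (v (k.succAbove m)) := by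
    rw [kap_sum c u v z (fun k => div_ne_zero (hz k) hc)]
    unfold Kiz
    have b1 : (∏ j : Fin (n + 1), ∏ k : Fin (n + 1), if (k : ℕ) < (j : ℕ) then
          gg c ((Fin.cons z u : Fin (n + 1) → ℂ) j) ((Fin.cons z u : Fin (n + 1) → ℂ) k) else 1)
        = (∏ j, gg c (u j) z) *
          ∏ j : Fin n, ∏ k : Fin n, if (k : ℕ) < (j : ℕ) then gg c (u j) (u k) else 1 := by
      rw [Fin.prod_univ_succ, Finset.prod_eq_one (fun k _ => by simp), one_mul,
        ← Finset.prod_mul_distrib]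
      refine Finset.prod_congr rfl fun j _ => ?_
      rw [Fin.prod_univ_succ]
      simp
    have b2 : (∏ j : Fin (n + 1), ∏ k : Fin (n + 1),
          hh c ((Fin.cons z u : Fin (n + 1) → ℂ) j) (v k))
        = (∏ k, hh c z (v k)) * ∏ j, ∏ k, hh c (u j) (v k) := by
      rw [Fin.prod_univ_succ]
      simp
    rw [b1, b2]
    ring
  rw [e1, interp c hc u v (kap c u v) hui hvi huv ?_ z hzv hzu]
  · refine Finset.sum_congr rfl fun k _ => ?_
    have a1 : (∏ m, ff c (v k) (v (k.succAbove m)))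
        = (∏ m, hh c (v k) (v (k.succAbove m))) * ∏ m, gg c (v k) (v (k.succAbove m)) := by
      rw [← Finset.prod_mul_distrib]
      refine Finset.prod_congr rfl fun m _ => (hh_mul_gg hc ?_).symm
      intro h
      exact Fin.succAbove_ne k m (hvi h).symm
    have a2 : (∏ j, ff c (u j) (v k)) = (∏ j, hh c (u j) (v k)) * ∏ j, gg c (u j) (v k) := by
      rw [← Finset.prod_mul_distrib]
      exact Finset.prod_congr rfl fun m _ => (hh_mul_gg hc (huv _ _)).symm
    rw [a1, a2, kap]
    ring
  · intro i
    rw [kap_sum c u v (u i) (fun k => div_ne_zero (hu i k) hc)]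
    rw [Matrix.det_zero_of_row_eq (i := 0) (j := i.succ) (Fin.succ_ne_zero i).symm, mul_zero]
    funext k
    simp

theorem exists_enum (S : Finset ℂ) {n : ℕ} (h : S.card = n) :
    ∃ a : Fin n → ℂ, Function.Injective a ∧ Finset.univ.image a = S := by
  let e := (S.equivFinOfCardEq h).symm
  refine ⟨fun i => (e i : ℂ), Subtype.val_injective.comp e.injective, ?_⟩
  ext x
  simp only [Finset.mem_image, Finset.mem_univ, true_and]
  constructor
  · rintro ⟨i, rfl⟩; exact (e i).2
  · intro hx; exact ⟨e.symm ⟨x, hx⟩, by simp⟩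

theorem KF_insert (c : ℂ) (hc : c ≠ 0) {S Q : Finset ℂ} {z : ℂ} (hzS : z ∉ S)
    (hzQ : ∀ q ∈ Q, z ≠ q ∧ z - q + c ≠ 0)
    (hSQ : ∀ x ∈ S, ∀ q ∈ Q, x ≠ q ∧ x - q + c ≠ 0) :
    KF c (insert z S) Q = ∑ k ∈ Q, gg c z k * cF c (Q.erase k) k * cG c S k * KF c S (Q.erase k) := by
  by_cases hcard : Q.card = S.card + 1
  · obtain ⟨a, ha, hS⟩ := exists_enum S rfl
    obtain ⟨b, hb, hQ⟩ := exists_enum Q hcard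
    have aS : ∀ i, a i ∈ S := fun i => by rw [← hS]; simp
    have bQ : ∀ i, b i ∈ Q := fun i => by rw [← hQ]; simp
    have za : ∀ i, z ≠ a i := fun i h => hzS (h ▸ aS i)
    have h1 : KF c (insert z S) Q = Kiz c (Fin.cons z a : Fin (S.card + 1) → ℂ) b := by
      refine KF_eq c ?_ hb ?_ hQ
      · rw [Fin.cons_injective_iff]
        refine ⟨?_, ha⟩
        rintro ⟨i, hi⟩
        exact za i hi.symm
      · ext x
        have : (∃ i, a i = x) ↔ x ∈ S := by
          conv_rhs => rw [← hS]
          simp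
        simp only [Finset.mem_image, Finset.mem_univ, true_and, Fin.exists_fin_succ, Fin.cons_zero,
          Fin.cons_succ, Finset.mem_insert, this]
        tauto
    rw [h1, Kiz_cons c hc a b z (fun k => (hzQ _ (bQ k)).2) (fun j k => (hSQ _ (aS j) _ (bQ k)).2)
      ha hb (fun j k => (hSQ _ (aS j) _ (bQ k)).1) (fun k => (hzQ _ (bQ k)).1) za]
    have h2 : ∀ F : ℂ → ℂ, ∑ k ∈ Q, F k = ∑ i, F (b i) := by
      intro F
      conv_lhs => rw [← hQ]
      exact Finset.sum_image (fun x _ y _ h => hb h)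
    rw [h2]
    refine Finset.sum_congr rfl fun k _ => ?_
    have inj : Function.Injective (fun m => b (k.succAbove m)) :=
      hb.comp Fin.succAbove_right_injective
    have im : Finset.univ.image (fun m => b (k.succAbove m)) = Q.erase (b k) := by
      ext x
      rw [Finset.mem_erase]
      conv_rhs => rw [← hQ]
      simp only [Finset.mem_image, Finset.mem_univ, true_and]
      constructor
      · rintro ⟨m, rfl⟩
        exact ⟨fun h => Fin.succAbove_ne k m (hb h), _, rfl⟩
      · rintro ⟨hx, j, rfl⟩
        have : j ≠ k := fun h => hx (by rw [h])
        obtain ⟨m, hm⟩ := Fin.exists_succAbove_eq this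
        exact ⟨m, by rw [hm]⟩
    rw [← KF_eq c ha inj hS im]
    congr 1
    congr 1
    · congr 1
      unfold cF
      rw [← im]
      exact (Finset.prod_image (fun x _ y _ h => inj h)).symm
    · unfold cG
      have : ∏ x ∈ S, ff c x (b k) = ∏ x ∈ Finset.univ.image a, ff c x (b k) := by rw [hS]
      rw [this, Finset.prod_image (fun x _ y _ h => ha h)]
  · rw [KF_zero, Finset.sum_eq_zero]
    · intro k hk
      rw [KF_zero, mul_zero]
      rw [Finset.card_erase_of_mem hk]
      have := Finset.card_pos.2 ⟨k, hk⟩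
      omega
    · rw [Finset.card_insert_of_notMem hzS]; omega

theorem KF_empty (c : ℂ) : KF c ∅ ∅ = 1 := by
  rw [KF_eq c (n := 0) (a := Fin.elim0) (b := Fin.elim0) (fun i => i.elim0) (fun i => i.elim0)
    (by simp) (by simp)]
  simp [Kiz]

section
variable {M : Type*} [AddCommGroup M] [Module ℂ M]

/-- normalized ordered product of operators along a list, applied to a vector -/
def opTT (c : ℂ) (t : ℂ → M →ₗ[ℂ] M) (xs : List ℂ) (m : M) : M :=
  (Hnorm c xs)⁻¹ • xs.foldr (fun x m => t x m) m

/-- ordered product of operators along a list, applied to a vector -/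
def opT (t : ℂ → M →ₗ[ℂ] M) (xs : List ℂ) (m : M) : M := xs.foldr (fun x m => t x m) m

/-- good set of parameters -/
def Good (c : ℂ) (W : Finset ℂ) : Prop := ∀ x ∈ W, ∀ y ∈ W, x ≠ y → x - y + c ≠ 0

theorem Good.mono {c : ℂ} {W W' : Finset ℂ} (h : Good c W) (hs : W' ⊆ W) : Good c W' :=
  fun x hx y hy => h x (hs hx) y (hs hy)

theorem opTT_cons (c : ℂ) (t : ℂ → M →ₗ[ℂ] M) (x : ℂ) (xs : List ℂ) (m : M) :
    opTT c t (x :: xs) m = ((xs.map fun y => hh c y x).prod)⁻¹ • t x (opTT c t xs m) := by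
  unfold opTT
  simp only [Hnorm, List.foldr_cons, mul_inv, mul_smul, map_smul]

theorem opT_perm {t : ℂ → M →ₗ[ℂ] M} (ht : ∀ z w, z ≠ w → ∀ m, t z (t w m) = t w (t z m))
    {xs ys : List ℂ} (h : xs.Perm ys) (m : M) : opT t xs m = opT t ys m := by
  unfold opT
  induction h with
  | nil => rfl
  | cons x _ ih => simp only [List.foldr_cons, ih]
  | swap x y l =>
    simp only [List.foldr_cons]
    by_cases hxy : y = x
    · rw [hxy]
    · exact ht y x hxy _
  | trans _ _ ih1 ih2 => rw [ih1, ih2]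

theorem opTT_perm {c : ℂ} (hc : c ≠ 0) {t : ℂ → M →ₗ[ℂ] M}
    (ht : ∀ z w, z ≠ w → ∀ m, ff c z w • t z (t w m) = -(ff c w z • t w (t z m)))
    {xs ys : List ℂ} (h : xs.Perm ys) (m : M) (ha : Admissible c xs) :
    opTT c t xs m = opTT c t ys m := by
  induction h with
  | nil => rfl
  | cons x hp ih =>
    rw [opTT_cons, opTT_cons, ih (List.Pairwise.of_cons ha), (hp.map _).prod_eq]
  | swap x y l =>
    simp only [Admissible, List.pairwise_cons, List.mem_cons, forall_eq_or_imp] at ha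
    obtain ⟨⟨⟨hne, h1, h2⟩, -⟩, -⟩ := ha
    rw [opTT_cons, opTT_cons, opTT_cons, opTT_cons]
    simp only [List.map_cons, List.prod_cons, map_smul, smul_smul]
    have e := ht y x hne (opTT c t l m)
    rw [← hh_mul_gg hc hne, ← hh_mul_gg hc (Ne.symm hne), gg_antisymm c y x] at e
    have hg : gg c y x ≠ 0 := div_ne_zero hc (sub_ne_zero.2 hne)
    have hyx : hh c y x ≠ 0 := div_ne_zero h1 hc
    have hxy : hh c x y ≠ 0 := div_ne_zero h2 hc
    have e2 : hh c y x • t y (t x (opTT c t l m)) = hh c x y • t x (t y (opTT c t l m)) := by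
      refine smul_right_injective M hg ?_
      simp only [smul_smul]
      rw [mul_comm, e, mul_neg, neg_smul, neg_neg, mul_comm]
    have e3 : t y (t x (opTT c t l m)) = ((hh c y x)⁻¹ * hh c x y) • t x (t y (opTT c t l m)) := by
      rw [mul_smul, ← e2, smul_smul, inv_mul_cancel₀ hyx, one_smul]
    rw [e3, smul_smul]
    congr 1
    field_simp
  | trans hp _ ih1 ih2 =>
    rw [ih1 ha]
    refine ih2 ?_
    refine (hp.pairwise_iff ?_).1 ha
    intro x y h
    exact ⟨h.1.symm, h.2.2, h.2.1⟩

/-- set version of `opTT` -/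
def TTF (c : ℂ) (t : ℂ → M →ₗ[ℂ] M) (S : Finset ℂ) (m : M) : M := opTT c t S.toList m

/-- set version of `opT` -/
def TPF (t : ℂ → M →ₗ[ℂ] M) (S : Finset ℂ) (m : M) : M := opT t S.toList m

theorem adm_of_good {c : ℂ} {xs : List ℂ} (hn : xs.Nodup) (h : Good c xs.toFinset) :
    Admissible c xs := by
  refine List.Pairwise.imp_of_mem ?_ hn
  intro a b ha hb hab
  exact ⟨hab, h a (by simpa using ha) b (by simpa using hb) hab,
    h b (by simpa using hb) a (by simpa using ha) (Ne.symm hab)⟩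

theorem opTT_eq_TTF {c : ℂ} (hc : c ≠ 0) {t : ℂ → M →ₗ[ℂ] M}
    (ht : ∀ z w, z ≠ w → ∀ m, ff c z w • t z (t w m) = -(ff c w z • t w (t z m)))
    {xs : List ℂ} (hn : xs.Nodup) (hg : Good c xs.toFinset) (m : M) :
    opTT c t xs m = TTF c t xs.toFinset m :=
  opTT_perm hc ht (List.toFinset_toList hn).symm m (adm_of_good hn hg)

theorem opT_eq_TPF {t : ℂ → M →ₗ[ℂ] M} (ht : ∀ z w, z ≠ w → ∀ m, t z (t w m) = t w (t z m))
    {xs : List ℂ} (hn : xs.Nodup) (m : M) : opT t xs m = TPF t xs.toFinset m :=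
  opT_perm ht (List.toFinset_toList hn).symm m

theorem TTF_empty (c : ℂ) (t : ℂ → M →ₗ[ℂ] M) (m : M) : TTF c t ∅ m = m := by
  simp [TTF, opTT, Hnorm]

theorem TPF_empty (t : ℂ → M →ₗ[ℂ] M) (m : M) : TPF t ∅ m = m := by
  simp [TPF, opT]

theorem TPF_insert {t : ℂ → M →ₗ[ℂ] M} (ht : ∀ z w, z ≠ w → ∀ m, t z (t w m) = t w (t z m))
    {S : Finset ℂ} {x : ℂ} (hx : x ∉ S) (m : M) : TPF t (insert x S) m = t x (TPF t S m) := by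
  unfold TPF
  rw [opT_perm ht (Finset.toList_insert hx) m]
  rfl

theorem TTF_insert {c : ℂ} (hc : c ≠ 0) {t : ℂ → M →ₗ[ℂ] M}
    (ht : ∀ z w, z ≠ w → ∀ m, ff c z w • t z (t w m) = -(ff c w z • t w (t z m)))
    {S : Finset ℂ} {x : ℂ} (hx : x ∉ S) (hg : Good c (insert x S)) (m : M) :
    cH c S x • TTF c t (insert x S) m = t x (TTF c t S m) := by
  unfold TTF
  rw [opTT_perm hc ht (Finset.toList_insert hx) m
    (adm_of_good (Finset.nodup_toList _) (by rwa [Finset.toList_toFinset])), opTT_cons,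
    Finset.prod_map_toList, smul_smul]
  have : cH c S x ≠ 0 := Finset.prod_ne_zero_iff.2 fun y hy =>
    div_ne_zero (hg y (by simp [hy]) x (by simp) (fun h => hx (h ▸ hy))) hc
  rw [show cH c S x * (∏ i ∈ S, hh c i x)⁻¹ = 1 from mul_inv_cancel₀ this, one_smul]

theorem TTF_smul (c : ℂ) (t : ℂ → M →ₗ[ℂ] M) (S : Finset ℂ) (a : ℂ) (m : M) :
    TTF c t S (a • m) = a • TTF c t S m := by
  unfold TTF opTT
  have : ∀ xs : List ℂ, xs.foldr (fun x m => t x m) (a • m) = a • xs.foldr (fun x m => t x m) m := by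
    intro xs
    induction xs with
    | nil => rfl
    | cons x xs ih => simp only [List.foldr_cons, ih, map_smul]
  rw [this, smul_comm]

/-- `(-1)^{|S|}` absorbed: `∏ (-f(x,z))` -/
def cN (c : ℂ) (S : Finset ℂ) (z : ℂ) : ℂ := ∏ x ∈ S, (-ff c x z)
/-- `g(x,S)` -/
def cR (c : ℂ) (S : Finset ℂ) (x : ℂ) : ℂ := ∏ y ∈ S, gg c x y

theorem cH_cR {c : ℂ} (hc : c ≠ 0) {S : Finset ℂ} {z : ℂ} (hz : z ∉ S) :
    cH c S z * cR c S z = cN c S z := by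
  unfold cH cR cN
  rw [← Finset.prod_mul_distrib]
  refine Finset.prod_congr rfl fun x hx => ?_
  rw [← hh_mul_gg hc (show x ≠ z from fun h => hz (h ▸ hx)), gg_antisymm c x z]
  ring

theorem comm_TTF {c : ℂ} (hc : c ≠ 0) {t01 t02 t12 t11 : ℂ → M →ₗ[ℂ] M}
    (hR : Rel c t01 t02 t12 t11) (S : Finset ℂ) (hg : Good c S) (m : M) :
    ∀ z, z ∉ S → t01 z (TTF c t02 S m) = cN c S z • TTF c t02 S (t01 z m)
      - ∑ x ∈ S, (gg c z x * cR c (S.erase x) x) • t02 z (TTF c t02 (S.erase x) (t01 x m)) := by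
  induction S using Finset.induction_on with
  | empty => intro z _; simp [TTF_empty, cN]
  | insert y S hy ih =>
    intro z hz
    simp only [Finset.mem_insert, not_or] at hz
    have hg' : Good c S := hg.mono (Finset.subset_insert _ _)
    have hH : cH c S y ≠ 0 := Finset.prod_ne_zero_iff.2 fun x hx =>
      div_ne_zero (hg x (by simp [hx]) y (by simp) (fun h => hy (h ▸ hx))) hc
    refine smul_right_injective M hH ?_
    change cH c S y • _ = cH c S y • _
    have ins := fun m => TTF_insert hc hR.r0202 hy hg m
    rw [← map_smul, ins, hR.r0102 z y hz.1, ih hg' z hz.2, ih hg' y hy, smul_sub,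
      Finset.sum_insert hy, Finset.erase_insert hy, smul_comm (cH c S y) (cN c _ z), ins]
    have e1 : cN c (insert y S) z = -ff c y z * cN c S z := by
      unfold cN; rw [Finset.prod_insert hy]
    have e2 : cH c S y • ∑ x ∈ S, (gg c z x * cR c ((insert y S).erase x) x) •
          t02 z (TTF c t02 ((insert y S).erase x) (t01 x m))
        = -(ff c y z • ∑ x ∈ S, (gg c z x * cR c (S.erase x) x) •
            t02 y (t02 z (TTF c t02 (S.erase x) (t01 x m))))
          - gg c z y • ∑ x ∈ S, (gg c y x * cR c (S.erase x) x) •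
            t02 z (t02 y (TTF c t02 (S.erase x) (t01 x m))) := by
      simp only [Finset.smul_sum, ← Finset.sum_neg_distrib, ← Finset.sum_sub_distrib]
      refine Finset.sum_congr rfl fun x hx => ?_
      have yx : y ≠ x := fun h => hy (h ▸ hx)
      have zx : z ≠ x := fun h => hz.2 (h ▸ hx)
      have hyx : y ∉ S.erase x := by simp [hy]
      have hgx : Good c (insert y (S.erase x)) :=
        hg.mono (Finset.insert_subset_insert _ (Finset.erase_subset _ _))
      have e3 : cR c (insert y (S.erase x)) x = gg c x y * cR c (S.erase x) x := by
        unfold cR; rw [Finset.prod_insert hyx]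
      rw [Finset.erase_insert_of_ne yx, cH_erase hx, mul_smul,
        smul_comm (cH c (S.erase x) y), ← map_smul, TTF_insert hc hR.r0202 hyx hgx, e3]
      rw [smul_comm (ff c y z), hR.r0202 y z (Ne.symm hz.1)]
      have f1 := hh_mul_gg hc (Ne.symm yx)
      have f2 := gg_three c hz.1 yx zx
      rw [ff_eq c (Ne.symm yx)] at f1
      rw [ff_eq c hz.1]
      rw [gg_antisymm c y x] at f1 ⊢
      match_scalars
      linear_combination (gg c z x * cR c (S.erase x) x) * f1 + cR c (S.erase x) x * f2
    rw [smul_add, e2, e1]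
    have e4 := cH_cR hc hy
    rw [smul_smul (cH c S y)]
    rw [show cH c S y * (gg c z y * cR c S y) = gg c z y * cN c S y by rw [← e4]; ring]
    simp only [map_sub, map_sum, map_smul]
    module

end

section
variable {M : Type*} [AddCommGroup M] [Module ℂ M]

theorem reindex1 (U : Finset ℂ) (F : Finset ℂ → ℂ → M) :
    ∑ S ∈ U.powerset, ∑ x ∈ S, F S x = ∑ S ∈ U.powerset, ∑ x ∈ U \ S, F (insert x S) x := by
  rw [Finset.sum_sigma', Finset.sum_sigma']
  refine Finset.sum_bij' (fun p _ => ⟨p.1.erase p.2, p.2⟩) (fun p _ => ⟨insert p.2 p.1, p.2⟩) ?_ ?_ ?_ ?_ ?_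
  · rintro ⟨S, x⟩ h
    simp only [Finset.mem_sigma, Finset.mem_powerset, Finset.mem_sdiff, Finset.mem_erase] at h ⊢
    exact ⟨(Finset.erase_subset _ _).trans h.1, h.1 h.2, by simp⟩
  · rintro ⟨S, x⟩ h
    simp only [Finset.mem_sigma, Finset.mem_powerset, Finset.mem_sdiff] at h ⊢
    exact ⟨Finset.insert_subset h.2.1 h.1, by simp⟩
  · rintro ⟨S, x⟩ h
    simp only [Finset.mem_sigma] at h
    simp [Finset.insert_erase h.2]
  · rintro ⟨S, x⟩ h
    simp only [Finset.mem_sigma, Finset.mem_sdiff] at h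
    simp [Finset.erase_insert h.2.2]
  · rintro ⟨S, x⟩ h
    simp only [Finset.mem_sigma] at h
    simp [Finset.insert_erase h.2]

theorem reindex2 (V : Finset ℂ) (F : Finset ℂ → ℂ → M) :
    ∑ Q ∈ V.powerset, ∑ k ∈ Q, F Q k
      = ∑ k ∈ V, ∑ Q ∈ (V.erase k).powerset, F (insert k Q) k := by
  rw [reindex1]
  refine Finset.sum_comm' ?_
  intro Q k
  simp only [Finset.mem_powerset, Finset.mem_sdiff, Finset.subset_erase]
  tauto

/-- `g(X,S)` -/
def cGG (c : ℂ) (X S : Finset ℂ) : ℂ := ∏ x ∈ X, ∏ s ∈ S, gg c x s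

/-- partial Bethe vector for fixed part of the second set -/
def Psi0 (c : ℂ) (t01 t02 : ℂ → M →ₗ[ℂ] M) (U Q : Finset ℂ) (ω : M) : M :=
  ∑ S ∈ U.powerset, (KF c S Q * cGG c (U \ S) S) • TTF c t02 S (TTF c t01 (U \ S) ω)

theorem cG_cH {c : ℂ} (hc : c ≠ 0) {X : Finset ℂ} {z : ℂ} (hz : z ∉ X) :
    cH c X z * (∏ x ∈ X, gg c x z) = cG c X z := by
  unfold cH cG
  rw [← Finset.prod_mul_distrib]
  exact Finset.prod_congr rfl fun x hx => hh_mul_gg hc (show x ≠ z from fun h => hz (h ▸ hx))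

theorem cGG_insert_left {c : ℂ} {X S : Finset ℂ} {z : ℂ} (hz : z ∉ X) :
    cGG c (insert z X) S = cR c S z * cGG c X S := by
  unfold cGG cR; rw [Finset.prod_insert hz]

theorem cGG_insert_right {c : ℂ} {X S : Finset ℂ} {z : ℂ} (hz : z ∉ S) :
    cGG c X (insert z S) = (∏ x ∈ X, gg c x z) * cGG c X S := by
  unfold cGG
  rw [← Finset.prod_mul_distrib]
  exact Finset.prod_congr rfl fun x _ => Finset.prod_insert hz

theorem cG_union {c : ℂ} {U S : Finset ℂ} (h : S ⊆ U) (k : ℂ) :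
    cG c U k = cG c S k * cG c (U \ S) k := by
  unfold cG; rw [mul_comm]; exact (Finset.prod_sdiff h).symm

theorem cH_union {c : ℂ} {U S : Finset ℂ} (h : S ⊆ U) (k : ℂ) :
    cH c U k = cH c S k * cH c (U \ S) k := by
  unfold cH; rw [mul_comm]; exact (Finset.prod_sdiff h).symm

theorem bracket {c : ℂ} (hc : c ≠ 0) {U S Q : Finset ℂ} {z : ℂ} (hS : S ⊆ U) (hzU : z ∉ U)
    (hUQ : Disjoint U Q) (hzQ : z ∉ Q) (hg : Good c (insert z U ∪ Q)) :
    cG c (U \ S) z * KF c (insert z S) Q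
      + ∑ x ∈ U \ S, gg c z x * cG c ((U \ S).erase x) x * KF c (insert x S) Q
      = ∑ k ∈ Q, gg c z k * cF c (Q.erase k) k * cG c U k * KF c S (Q.erase k) := by
  have hSQ : ∀ x ∈ S, ∀ q ∈ Q, x ≠ q ∧ x - q + c ≠ 0 := by
    intro x hx q hq
    have : x ≠ q := fun h => Finset.disjoint_left.1 hUQ (hS hx) (h ▸ hq)
    exact ⟨this, hg x (by simp [hS hx]) q (by simp [hq]) this⟩
  rw [KF_insert c hc (fun h => hzU (hS h)) (fun q hq => by
      have : z ≠ q := fun h => hzQ (h ▸ hq)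
      exact ⟨this, hg z (by simp) q (by simp [hq]) this⟩) hSQ]
  have e : ∑ x ∈ U \ S, gg c z x * cG c ((U \ S).erase x) x * KF c (insert x S) Q
      = ∑ k ∈ Q, ∑ x ∈ U \ S, gg c z x * cG c ((U \ S).erase x) x *
        (gg c x k * cF c (Q.erase k) k * cG c S k * KF c S (Q.erase k)) := by
    rw [Finset.sum_comm]
    refine Finset.sum_congr rfl fun x hx => ?_
    rw [Finset.mem_sdiff] at hx
    rw [KF_insert c hc hx.2 (fun q hq => by
      have : x ≠ q := fun h => Finset.disjoint_left.1 hUQ hx.1 (h ▸ hq)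
      exact ⟨this, hg x (by simp [hx.1]) q (by simp [hq]) this⟩) hSQ, Finset.mul_sum]
  rw [e, Finset.mul_sum, ← Finset.sum_add_distrib]
  refine Finset.sum_congr rfl fun k hk => ?_
  have hp := pf_ff c k (U \ S) (fun h => Finset.disjoint_left.1 hUQ (Finset.mem_sdiff.1 h).1 hk) z
    (fun h => hzU (Finset.mem_sdiff.1 h).1) (fun h => hzQ (h ▸ hk))
  change cG c (U \ S) z * _ = _ * cG c (U \ S) k + ∑ x ∈ U \ S, gg c x z * cG c ((U \ S).erase x) x * _ at hp
  have e2 : ∑ x ∈ U \ S, gg c z x * cG c ((U \ S).erase x) x *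
        (gg c x k * cF c (Q.erase k) k * cG c S k * KF c S (Q.erase k))
      = -(∑ x ∈ U \ S, gg c x z * cG c ((U \ S).erase x) x * gg c x k) *
        (cF c (Q.erase k) k * cG c S k * KF c S (Q.erase k)) := by
    rw [← Finset.sum_neg_distrib, Finset.sum_mul]
    refine Finset.sum_congr rfl fun x _ => ?_
    rw [gg_antisymm c x z]; ring
  rw [e2, cG_union hS]
  linear_combination (cF c (Q.erase k) k * cG c S k * KF c S (Q.erase k)) * hp

theorem Psi0_rec {c : ℂ} (hc : c ≠ 0) {t01 t02 t12 t11 : ℂ → M →ₗ[ℂ] M}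
    (hR : Rel c t01 t02 t12 t11) {U Q : Finset ℂ} {z : ℂ} (hzU : z ∉ U)
    (hUQ : Disjoint U Q) (hzQ : z ∉ Q) (hg : Good c (insert z U ∪ Q)) (ω : M) :
    cH c U z • Psi0 c t01 t02 (insert z U) Q ω = t01 z (Psi0 c t01 t02 U Q ω)
      + ∑ k ∈ Q, (gg c z k * cF c (Q.erase k) k * cG c U k) •
        t02 z (Psi0 c t01 t02 U (Q.erase k) ω) := by
  have hgU : Good c (insert z U) := hg.mono Finset.subset_union_left
  -- right-hand side
  have r1 : ∑ k ∈ Q, (gg c z k * cF c (Q.erase k) k * cG c U k) •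
        t02 z (Psi0 c t01 t02 U (Q.erase k) ω)
      = ∑ S ∈ U.powerset, (cGG c (U \ S) S * (cG c (U \ S) z * KF c (insert z S) Q
      + ∑ x ∈ U \ S, gg c z x * cG c ((U \ S).erase x) x * KF c (insert x S) Q)) •
        t02 z (TTF c t02 S (TTF c t01 (U \ S) ω)) := by
    unfold Psi0
    simp only [map_sum, map_smul, Finset.smul_sum, smul_smul]
    rw [Finset.sum_comm]
    refine Finset.sum_congr rfl fun S hS => ?_
    rw [Finset.mem_powerset] at hS
    rw [bracket hc hS hzU hUQ hzQ hg, ← Finset.sum_smul, Finset.mul_sum]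
    congr 1
    refine Finset.sum_congr rfl fun k _ => ?_
    ring
  have r2 : t01 z (Psi0 c t01 t02 U Q ω)
      = ∑ S ∈ U.powerset, (KF c S Q * cGG c (U \ S) S * cN c S z) •
          TTF c t02 S (t01 z (TTF c t01 (U \ S) ω))
        - ∑ S ∈ U.powerset, (cGG c (U \ S) S * 
          ∑ x ∈ U \ S, gg c z x * cG c ((U \ S).erase x) x * KF c (insert x S) Q) •
        t02 z (TTF c t02 S (TTF c t01 (U \ S) ω)) := by
    have h1 : ∑ S ∈ U.powerset, (cGG c (U \ S) S * 
          ∑ x ∈ U \ S, gg c z x * cG c ((U \ S).erase x) x * KF c (insert x S) Q) •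
        t02 z (TTF c t02 S (TTF c t01 (U \ S) ω))
        = ∑ S ∈ U.powerset, ∑ x ∈ S, (KF c S Q * cGG c (U \ S) S * (gg c z x * cR c (S.erase x) x)) •
          t02 z (TTF c t02 (S.erase x) (t01 x (TTF c t01 (U \ S) ω))) := by
      rw [reindex1 U (fun S x => (KF c S Q * cGG c (U \ S) S * (gg c z x * cR c (S.erase x) x)) •
          t02 z (TTF c t02 (S.erase x) (t01 x (TTF c t01 (U \ S) ω))))]
      refine Finset.sum_congr rfl fun S hS => ?_
      rw [Finset.mem_powerset] at hS
      rw [Finset.mul_sum, Finset.sum_smul]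
      refine Finset.sum_congr rfl fun x hx => ?_
      have hxS := (Finset.mem_sdiff.1 hx).2
      have hxx : x ∉ (U \ S).erase x := by simp
      have e1 : U \ insert x S = (U \ S).erase x := by
        ext y; simp only [Finset.mem_sdiff, Finset.mem_insert, Finset.mem_erase]; tauto
      have e2 : insert x ((U \ S).erase x) = U \ S := Finset.insert_erase hx
      have e3 := TTF_insert hc hR.r0101 hxx (hgU.mono (by
        rw [e2]; exact Finset.sdiff_subset.trans (Finset.subset_insert _ _))) ω
      have e4 := cGG_insert_left (c := c) (S := S) hxx
      rw [e2] at e3 e4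
      rw [e1, Finset.erase_insert hxS, ← e3, TTF_smul, map_smul, smul_smul, e4,
        cGG_insert_right hxS, ← cG_cH hc hxx]
      congr 1
      ring
    rw [h1, ← Finset.sum_sub_distrib]
    unfold Psi0
    rw [map_sum]
    refine Finset.sum_congr rfl fun S hS => ?_
    rw [Finset.mem_powerset] at hS
    rw [map_smul, comm_TTF hc hR S (hgU.mono (hS.trans (Finset.subset_insert _ _))) _ z
      (fun h => hzU (hS h)), smul_sub, smul_smul, Finset.smul_sum]
    simp only [smul_smul]
  have r3 : cH c U z • Psi0 c t01 t02 (insert z U) Q ω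
      = ∑ S ∈ U.powerset, (KF c S Q * cGG c (U \ S) S * cN c S z) •
          TTF c t02 S (t01 z (TTF c t01 (U \ S) ω))
        + ∑ S ∈ U.powerset, (cGG c (U \ S) S * (cG c (U \ S) z * KF c (insert z S) Q)) •
          t02 z (TTF c t02 S (TTF c t01 (U \ S) ω)) := by
    unfold Psi0
    rw [Finset.sum_powerset_insert hzU, smul_add, Finset.smul_sum, Finset.smul_sum]
    congr 1
    · refine Finset.sum_congr rfl fun S hS => ?_
      rw [Finset.mem_powerset] at hS
      have hzS : z ∉ S := fun h => hzU (hS h)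
      have hzX : z ∉ U \ S := fun h => hzU (Finset.mem_sdiff.1 h).1
      rw [Finset.insert_sdiff_of_notMem _ hzS, ← TTF_insert hc hR.r0101 hzX (hgU.mono
        (Finset.insert_subset_insert _ Finset.sdiff_subset)), TTF_smul, smul_smul, smul_smul,
        cGG_insert_left hzX, ← cH_cR hc hzS, cH_union hS]
      congr 1
      ring
    · refine Finset.sum_congr rfl fun S hS => ?_
      rw [Finset.mem_powerset] at hS
      have hzS : z ∉ S := fun h => hzU (hS h)
      have hzX : z ∉ U \ S := fun h => hzU (Finset.mem_sdiff.1 h).1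
      have e1 : insert z U \ insert z S = U \ S := by
        ext y; simp only [Finset.mem_sdiff, Finset.mem_insert]
        constructor
        · tauto
        · rintro ⟨h1, h2⟩
          have : y ≠ z := fun h => hzU (h ▸ h1)
          tauto
      rw [e1, ← TTF_insert hc hR.r0202 hzS (hgU.mono
        (Finset.insert_subset_insert _ hS)), smul_smul, smul_smul,
        cGG_insert_right hzS, ← cG_cH hc hzX, cH_union hS]
      congr 1
      ring
  rw [r1, r2, r3]
  simp only [mul_add, add_smul, Finset.sum_add_distrib]
  abel

/-- the Bethe vector as a function of finite sets -/
def PhiF (c : ℂ) (l : ℂ → ℂ) (t01 t02 t12 : ℂ → M →ₗ[ℂ] M) (Ω : M) (U V : Finset ℂ) : M :=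
  ∑ Q ∈ V.powerset, (∏ q ∈ Q, (l q * cF c (V \ Q) q)) •
    Psi0 c t01 t02 U Q (TPF t12 (V \ Q) Ω)

theorem PhiF_recU {c : ℂ} (hc : c ≠ 0) {l : ℂ → ℂ} {t01 t02 t12 t11 : ℂ → M →ₗ[ℂ] M}
    (hR : Rel c t01 t02 t12 t11) {Ω : M} {U V : Finset ℂ} {z : ℂ} (hzU : z ∉ U)
    (hUV : Disjoint U V) (hzV : z ∉ V) (hg : Good c (insert z U ∪ V)) :
    RecU c l t01 t02 (PhiF c l t01 t02 t12 Ω) U V z := by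
  unfold RecU PhiF
  rw [Finset.smul_sum]
  have h1 : ∀ Q ∈ V.powerset, cH c U z • (∏ q ∈ Q, (l q * cF c (V \ Q) q)) •
        Psi0 c t01 t02 (insert z U) Q (TPF t12 (V \ Q) Ω)
      = (∏ q ∈ Q, (l q * cF c (V \ Q) q)) • t01 z (Psi0 c t01 t02 U Q (TPF t12 (V \ Q) Ω))
       + ∑ k ∈ Q, ((∏ q ∈ Q, (l q * cF c (V \ Q) q)) * (gg c z k * cF c (Q.erase k) k * cG c U k)) •
        t02 z (Psi0 c t01 t02 U (Q.erase k) (TPF t12 (V \ Q) Ω)) := by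
    intro Q hQ
    rw [Finset.mem_powerset] at hQ
    rw [smul_comm, Psi0_rec hc hR hzU (hUV.mono_right hQ) (fun h => hzV (hQ h))
      (hg.mono (Finset.union_subset_union_right hQ)), smul_add, Finset.smul_sum]
    simp only [smul_smul]
  rw [Finset.sum_congr rfl h1, Finset.sum_add_distrib, reindex2 V (fun Q k =>
    ((∏ q ∈ Q, (l q * cF c (V \ Q) q)) * (gg c z k * cF c (Q.erase k) k * cG c U k)) •
        t02 z (Psi0 c t01 t02 U (Q.erase k) (TPF t12 (V \ Q) Ω)))]
  simp only [map_sum, map_smul]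
  congr 1
  refine Finset.sum_congr rfl fun k hk => ?_
  rw [Finset.smul_sum]
  refine Finset.sum_congr rfl fun Q hQ => ?_
  rw [Finset.mem_powerset] at hQ
  have hkQ : k ∉ Q := fun h => by simpa using hQ h
  have e1 : V \ insert k Q = (V.erase k) \ Q := by
    ext y; simp only [Finset.mem_sdiff, Finset.mem_insert, Finset.mem_erase]; tauto
  rw [Finset.prod_insert hkQ, Finset.erase_insert hkQ, e1, smul_smul]
  congr 1
  have e2 : cF c (V.erase k) k = cF c (V.erase k \ Q) k * cF c Q k := by
    unfold cF; exact (Finset.prod_sdiff hQ).symm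
  unfold cL
  rw [e2]
  ring

theorem PhiF_empty (c : ℂ) (l : ℂ → ℂ) (t01 t02 t12 : ℂ → M →ₗ[ℂ] M) (Ω : M) (V : Finset ℂ) :
    PhiF c l t01 t02 t12 Ω ∅ V = TPF t12 V Ω := by
  unfold PhiF Psi0
  rw [Finset.sum_eq_single ∅]
  · simp [TTF_empty, KF_empty, cGG]
  · intro Q _ hQ
    rw [Finset.powerset_empty, Finset.sum_singleton, KF_zero, zero_mul, zero_smul, smul_zero]
    rw [Finset.card_empty]
    exact fun h => hQ (Finset.card_eq_zero.1 h.symm)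
  · simp

theorem PhiF_recV {c : ℂ} (hc : c ≠ 0) {l : ℂ → ℂ} {t01 t02 t12 t11 : ℂ → M →ₗ[ℂ] M}
    (hR : Rel c t01 t02 t12 t11) {Ω : M} (hΩ : ∀ w, t11 w Ω = l w • Ω) {U V : Finset ℂ} {w : ℂ}
    (hwU : w ∉ U) (hUV : Disjoint U V) (hwV : w ∉ V) (hg : Good c (insert w (U ∪ V))) :
    RecV c l t02 t12 (PhiF c l t01 t02 t12 Ω) U V w := by
  refine (joint (t11 := t11) (t01 := t01) hc hR (insert w (U ∪ V)) hg ?_ ?_ ?_ U ?_ V w ?_ (by simp) hUV hwU hwV).1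
  · intro V w hw
    rw [PhiF_empty, PhiF_empty, TPF_insert hR.r1212 hw]
  · intro w
    rw [PhiF_empty, TPF_empty, hΩ]
  · intro U' V' z hU' hV' hz hd h1 h2
    exact PhiF_recU hc hR h1 hd h2 (hg.mono (Finset.union_subset (Finset.insert_subset hz hU') hV'))
  · exact Finset.subset_union_left.trans (Finset.subset_insert _ _)
  · exact Finset.subset_union_right.trans (Finset.subset_insert _ _)
end

section final
variable {M : Type*} [AddCommGroup M] [Module ℂ M] [Module A M] [IsScalarTower ℂ A M]

theorem a_smul_comm (a : A) (r : ℂ) (m : M) : a • (r • m) = r • (a • m) := by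
  rw [← algebraMap_smul A r m, ← algebraMap_smul A r (a • m), ← mul_smul, ← mul_smul,
    Algebra.commutes]

/-- the operator of left multiplication -/
def tOp (t : ℂ → A) (z : ℂ) : M →ₗ[ℂ] M where
  toFun m := t z • m
  map_add' := smul_add _
  map_smul' r m := a_smul_comm _ r m

theorem tOp_apply (t : ℂ → A) (z : ℂ) (m : M) : tOp t z m = t z • m := rfl

theorem ff_one {c z w : ℂ} (h : z ≠ w) : ff c z w = 1 + gg c z w := by
  have := sub_ne_zero.2 h
  unfold ff gg
  field_simp

theorem gg_swap (c z w : ℂ) : gg c w z = - gg c z w := by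
  unfold gg
  rw [← neg_sub, div_neg]

theorem rel_of_fam {c : ℂ} {T : Fin 3 → Fin 3 → ℂ → A} (hT : IsTFam c p12 T) :
    Rel c (tOp (M := M) (T 0 1)) (tOp (T 0 2)) (tOp (T 1 2)) (tOp (T 1 1)) := by
  have key : ∀ i j k l : Fin 3, ∀ z w : ℂ, z ≠ w → ∀ m : M,
      tOp (T i j) z (tOp (T k l) w m)
        - ((-1 : ℂ) ^ ((p12 i + p12 j) * (p12 k + p12 l))) • (tOp (T k l) w (tOp (T i j) z m))
      = ((-1 : ℂ) ^ (p12 l * (p12 i + p12 j) + p12 i * p12 j) * gg c z w) •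
          (tOp (T i l) z (tOp (T k j) w m) - tOp (T i l) w (tOp (T k j) z m)) := by
    intro i j k l z w h m
    have := congrArg (fun a => a • m) (hT i j k l z w h)
    simpa only [sub_smul, smul_assoc, mul_smul, tOp_apply] using this
  have q0 : p12 0 = 0 := rfl
  have q1 : p12 1 = 1 := rfl
  have q2 : p12 2 = 1 := rfl
  constructor
  · intro z w h m
    have H := key 0 1 0 2 z w h m
    try simp only [ff_one h, ff_one h.symm, gg_swap c z w]
    norm_num [q0, q1, q2] at H
    linear_combination (norm := module) H
  · intro z w h m
    have H := key 0 1 1 2 z w h m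
    try simp only [ff_one h, ff_one h.symm, gg_swap c z w]
    norm_num [q0, q1, q2] at H
    linear_combination (norm := module) H
  · intro z w h m
    have H := key 0 2 1 2 z w h m
    try simp only [ff_one h, ff_one h.symm, gg_swap c z w]
    norm_num [q0, q1, q2] at H
    linear_combination (norm := module) -H
  · intro z w h m
    have H := key 0 2 0 2 z w h m
    try simp only [ff_one h, ff_one h.symm, gg_swap c z w]
    norm_num [q0, q1, q2] at H
    linear_combination (norm := module) H
  · intro z w h m
    have H := key 0 1 0 1 z w h m
    try simp only [ff_one h, ff_one h.symm, gg_swap c z w]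
    norm_num [q0, q1, q2] at H
    linear_combination (norm := module) H
  · intro z w h m
    have H := key 1 2 1 2 z w h m
    have H' := key 1 2 1 2 w z h.symm m
    rw [gg_swap c z w] at H'
    norm_num [q0, q1, q2] at H H'
    linear_combination (norm := module) (1/2 : ℂ) • H - (1/2 : ℂ) • H'
  · intro z w h m
    have H := key 0 1 1 1 z w h m
    try simp only [ff_one h, ff_one h.symm, gg_swap c z w]
    norm_num [q0, q1, q2] at H
    linear_combination (norm := module) -H
  · intro z w h m
    have H := key 0 2 1 1 z w h m
    try simp only [ff_one h, ff_one h.symm, gg_swap c z w]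
    norm_num [q0, q1, q2] at H
    linear_combination (norm := module) -H
  · intro z w h m
    have H := key 1 1 1 2 w z h.symm m
    try simp only [ff_one h, ff_one h.symm, gg_swap c z w] at H ⊢
    norm_num [q0, q1, q2] at H
    linear_combination (norm := module) H

theorem Tprod_smul (t : ℂ → A) (xs : List ℂ) (m : M) : Tprod t xs • m = opT (tOp t) xs m := by
  unfold Tprod opT
  induction xs with
  | nil => simp
  | cons x xs ih => simp only [List.map_cons, List.prod_cons, mul_smul, List.foldr_cons, ih]; rfl

theorem TT_smul (c : ℂ) (t : ℂ → A) (xs : List ℂ) (m : M) :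
    TT c t xs • m = opTT c (tOp t) xs m := by
  unfold TT opTT
  rw [smul_assoc, Tprod_smul]
  rfl

theorem sel_nodup {u : List ℂ} (hu : u.Nodup) (S : Finset (Fin u.length)) : (sel u S).Nodup := by
  unfold sel
  exact (Finset.sort_nodup _ _).map (List.nodup_iff_injective_get.1 hu)

theorem sel_toFinset (u : List ℂ) (S : Finset (Fin u.length)) :
    (sel u S).toFinset = S.image u.get := by
  ext x
  simp [sel]

theorem image_compl {u : List ℂ} (hu : u.Nodup) (S : Finset (Fin u.length)) :
    Sᶜ.image u.get = u.toFinset \ S.image u.get := by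
  have hi := List.nodup_iff_injective_get.1 hu
  have h : u.toFinset = Finset.univ.image u.get := by
    ext x; simp [List.mem_iff_get]
  rw [h, ← Finset.image_sdiff _ _ hi, Finset.compl_eq_univ_sdiff]

theorem sum_sel {u : List ℂ} (hu : u.Nodup) (F : Finset ℂ → M) :
    ∑ S : Finset (Fin u.length), F (S.image u.get) = ∑ S ∈ u.toFinset.powerset, F S := by
  have hi := List.nodup_iff_injective_get.1 hu
  have h : u.toFinset = Finset.univ.image u.get := by
    ext x; simp [List.mem_iff_get]
  refine Finset.sum_nbij (fun S => S.image u.get) ?_ ?_ ?_ ?_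
  · intro S _
    rw [Finset.mem_powerset, h]
    exact Finset.image_subset_image (Finset.subset_univ _)
  · intro S _ S' _ hs
    exact Finset.image_injective hi hs
  · intro S hS
    rw [Finset.mem_coe, Finset.mem_powerset, h] at hS
    obtain ⟨S', _, h'⟩ := Finset.subset_image_iff.1 hS
    exact ⟨S', by simp, h'⟩
  · intro S _; rfl

theorem PhiTB_smul {c : ℂ} (hc : c ≠ 0) {T : Fin 3 → Fin 3 → ℂ → A} (hT : IsTFam c p12 T)
    (l : ℂ → ℂ) (Ω : M) {u v : List ℂ} (hu : u.Nodup) (hv : v.Nodup) (hg : Good c u.toFinset) :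
    PhiTB c T l u v • Ω
      = PhiF c l (tOp (T 0 1)) (tOp (T 0 2)) (tOp (T 1 2)) Ω u.toFinset v.toFinset := by
  have hR := rel_of_fam (M := M) hT
  unfold PhiTB PhiF Psi0
  rw [← sum_sel hv]
  simp only [Finset.sum_smul]
  rw [Finset.sum_comm]
  refine Finset.sum_congr rfl fun Q _ => ?_
  rw [← sum_sel hu, Finset.smul_sum]
  refine Finset.sum_congr rfl fun S _ => ?_
  have hiu := List.nodup_iff_injective_get.1 hu
  have hiv := List.nodup_iff_injective_get.1 hv
  split_ifs with hcard
  · have hsub : ∀ S' : Finset (Fin u.length), (sel u S').toFinset ⊆ u.toFinset := by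
      intro S' x hx
      rw [sel_toFinset] at hx
      obtain ⟨i, _, rfl⟩ := Finset.mem_image.1 hx
      simp
    rw [smul_assoc, mul_smul (_ : A), mul_smul (_ : A), Tprod_smul, TT_smul, TT_smul,
      opTT_eq_TTF hc hR.r0202 (sel_nodup hu _) (hg.mono (hsub _)),
      opTT_eq_TTF hc hR.r0101 (sel_nodup hu _) (hg.mono (hsub _)),
      opT_eq_TPF hR.r1212 (sel_nodup hv _), KizL_eq_KF c (sel_nodup hu _) (sel_nodup hv _)]
    simp only [prodFF, prodGG, lamP]
    simp only [← List.prod_toFinset _ (sel_nodup hu _), ← List.prod_toFinset _ (sel_nodup hv _)]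
    simp only [sel_toFinset, image_compl hu, image_compl hv]
    rw [smul_smul]
    congr 1
    simp only [cGG, cF, Finset.prod_mul_distrib]
    ring
  · rw [KF_zero, zero_mul]
    · simp only [zero_smul, smul_zero]
    rwa [Finset.card_image_of_injective _ hiu, Finset.card_image_of_injective _ hiv]

theorem eraseIdx_toFinset {u : List ℂ} (hu : u.Nodup) (j : Fin u.length) :
    (u.eraseIdx (j : ℕ)).toFinset = u.toFinset.erase (u.get j) := by
  have h : u.eraseIdx (j : ℕ) = u.erase (u.get j) := (hu.erase_get j).symm
  rw [h]
  ext x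
  simp [hu.mem_erase_iff]

theorem final {c : ℂ} (hc : c ≠ 0) {T : Fin 3 → Fin 3 → ℂ → A}
    (hT : IsTFam c p12 T) (lam : Fin 3 → ℂ → ℂ) (Ω : M)
    (hw1 : ∀ i : Fin 3, ∀ z : ℂ, T i i z • Ω = lam i z • Ω)
    (v1 : ℂ) (u v' : List ℂ) (hadm : Admissible c (u ++ (v1 :: v'))) :
    ((-1 : ℂ) ^ (v1 :: v').length) • (PhiTB c T (lam 1) u (v1 :: v') • Ω)
      = -(T 1 2 v1 • (((-1 : ℂ) ^ v'.length) • (PhiTB c T (lam 1) u v' • Ω)))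
        - ∑ j : Fin u.length,
            (lam 1 (u.get j) * gg c (u.get j) v1 * prodFF c [u.get j] v' *
                prodGG c (u.eraseIdx (j : ℕ)) [u.get j]) •
              (T 0 2 v1 •
                (((-1 : ℂ) ^ v'.length) •
                  (PhiTB c T (lam 1) (u.eraseIdx (j : ℕ)) v' • Ω))) := by
  have hnd : (u ++ (v1 :: v')).Nodup := hadm.imp fun h => h.1
  have hgood : Good c (u ++ (v1 :: v')).toFinset := by
    intro x hx y hy hxy
    rw [List.mem_toFinset] at hx hy
    have hs : ∀ ⦃x y : ℂ⦄, (x ≠ y ∧ x - y + c ≠ 0 ∧ y - x + c ≠ 0) →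
      (y ≠ x ∧ y - x + c ≠ 0 ∧ x - y + c ≠ 0) := fun x y h => ⟨h.1.symm, h.2.2, h.2.1⟩
    have : Std.Symm (fun x y : ℂ => x ≠ y ∧ x - y + c ≠ 0 ∧ y - x + c ≠ 0) := ⟨fun x y h => hs h⟩
    exact (List.Pairwise.forall hadm hx hy hxy).2.1
  have hu : u.Nodup := hnd.of_append_left
  have hvv : (v1 :: v').Nodup := hnd.of_append_right
  have hv : v'.Nodup := hvv.of_cons
  have hv1 : v1 ∉ v' := (List.nodup_cons.1 hvv).1
  have hdis := List.disjoint_of_nodup_append hnd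
  have hR := rel_of_fam (M := M) hT
  have hrec := PhiF_recV (l := lam 1) (Ω := Ω) (U := u.toFinset) (V := v'.toFinset) (w := v1) hc hR (fun w => hw1 1 w)
    (by rw [List.mem_toFinset]; exact fun h => hdis h (by simp))
    (by
      rw [Finset.disjoint_left]
      intro x hx hx'
      rw [List.mem_toFinset] at hx hx'
      exact hdis hx (by simp [hx']))
    (by rwa [List.mem_toFinset])
    (hgood.mono (by intro x hx; simp at hx ⊢; tauto))
  have hgu : Good c u.toFinset := hgood.mono (by intro x hx; simp at hx ⊢; tauto)
  have hge : ∀ j : Fin u.length, PhiTB c T (lam 1) (u.eraseIdx (j : ℕ)) v' • Ω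
      = PhiF c (lam 1) (tOp (T 0 1)) (tOp (T 0 2)) (tOp (T 1 2)) Ω (u.toFinset.erase (u.get j)) v'.toFinset := by
    intro j
    rw [PhiTB_smul hc hT _ _ (hu.sublist (List.eraseIdx_sublist _ _)) hv, eraseIdx_toFinset hu]
    rw [eraseIdx_toFinset hu]
    exact hgu.mono (Finset.erase_subset _ _)
  unfold RecV at hrec
  rw [PhiTB_smul hc hT _ _ hu hvv hgu, PhiTB_smul hc hT _ _ hu hv hgu, List.toFinset_cons, hrec]
  have hsum : ∀ G : ℂ → M, ∑ j ∈ u.toFinset, G j = ∑ j : Fin u.length, G (u.get j) := by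
    intro G
    have h : u.toFinset = Finset.univ.image u.get := by
      ext x; simp [List.mem_iff_get]
    rw [h, Finset.sum_image (fun x _ y _ h => List.nodup_iff_injective_get.1 hu h)]
  rw [hsum, List.length_cons, pow_succ, a_smul_comm (T 1 2 v1)]
  rw [mul_neg_one, neg_smul, smul_add, neg_add, ← sub_eq_add_neg, Finset.smul_sum]
  congr 1
  refine Finset.sum_congr rfl fun j _ => ?_
  rw [hge, a_smul_comm (T 0 2 v1), smul_smul, smul_smul]
  congr 1
  have e1 : prodFF c [u.get j] v' = cF c v'.toFinset (u.get j) := by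
    simp only [prodFF, List.map_cons, List.map_nil, List.prod_cons, List.prod_nil, mul_one, cF]
    rw [List.prod_toFinset _ hv]
  have e2 : prodGG c (u.eraseIdx (j : ℕ)) [u.get j] = ∏ x ∈ u.toFinset.erase (u.get j), gg c x (u.get j) := by
    simp only [prodGG, List.map_cons, List.map_nil, List.prod_cons, List.prod_nil, mul_one]
    rw [← eraseIdx_toFinset hu, List.prod_toFinset _ (hu.sublist (List.eraseIdx_sublist _ _))]
  rw [e1, e2]
  unfold cP
  ring
end final

/-- second recursion for the `Y(1|2)` Bethe vector
`Φ̃ = (−1)^b • PhiTB • Ω`. -/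
theorem statement10 {M : Type*} [AddCommGroup M] [Module ℂ M] [Module A M]
    [IsScalarTower ℂ A M]
    (c : ℂ) (hc : c ≠ 0) (T : Fin 3 → Fin 3 → ℂ → A)
    (hT : IsTFam c p12 T) (lam : Fin 3 → ℂ → ℂ) (Ω : M)
    (hw0 : ∀ i j : Fin 3, j < i → ∀ z : ℂ, T i j z • Ω = 0)
    (hw1 : ∀ i : Fin 3, ∀ z : ℂ, T i i z • Ω = lam i z • Ω)
    (v1 : ℂ) (u v' : List ℂ) (hadm : Admissible c (u ++ (v1 :: v'))) :
    ((-1 : ℂ) ^ (v1 :: v').length) • (PhiTB c T (lam 1) u (v1 :: v') • Ω)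
      = -(T 1 2 v1 • (((-1 : ℂ) ^ v'.length) • (PhiTB c T (lam 1) u v' • Ω)))
        - ∑ j : Fin u.length,
            (lam 1 (u.get j) * gg c (u.get j) v1 * prodFF c [u.get j] v' *
                prodGG c (u.eraseIdx (j : ℕ)) [u.get j]) •
              (T 0 2 v1 •
                (((-1 : ℂ) ^ v'.length) •
                  (PhiTB c T (lam 1) (u.eraseIdx (j : ℕ)) v' • Ω))) :=
  final hc hT lam Ω hw1 v1 u v' hadm

end Bethe
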